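/- (Estimation error of the bootstrap quantile.) Under the stated assumptions, for every α ∈ (0,1) there exist constants C₁₂, C₁₃ > 0 and N₀ such that for all n ≥ N₀, writing r_n = (log n)^{3/8} n^{−1/8}: (i) Pⁿ( Q̂_α(λ_1,…,λ_n) < Q(α + C₁₂ r_n) − C₁₃ r_n ) ≤ 5/n, and (ii) Pⁿ( Q̂_α(λ_1,…,λ_n) > Q(α − C₁₂ r_n) + C₁₃ r_n ) ≤ 5/n. -/

import Mathlib

open MeasureTheory ProbabilityTheory Set Filter

noncomputable section

/-- A landscape-type function for `T`: 1-Lipschitz, with values in `[0, T/2]`,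
and vanishing outside `[0, T]`. -/
def IsLandscapeType (T : ℝ) (f : ℝ → ℝ) : Prop :=
  LipschitzWith 1 f ∧ (∀ t, 0 ≤ f t ∧ f t ≤ T / 2) ∧ ∀ t ∉ Set.Icc (0 : ℝ) T, f t = 0

/-- The Borel σ-algebra on the space `C(ℝ, ℝ)` of continuous functions with the
topology of uniform convergence on compact sets (the compact-open topology). -/
instance : MeasurableSpace C(ℝ, ℝ) := borel _

instance : BorelSpace C(ℝ, ℝ) := ⟨rfl⟩

/-- The mean function `μ(t) = ∫ λ(t) dP(λ)`. -/
def lmean (P : Measure C(ℝ, ℝ)) (t : ℝ) : ℝ := ∫ f, f t ∂P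

/-- The variance function `σ(t)² = ∫ λ(t)² dP(λ) − μ(t)²`. -/
def lvar (P : Measure C(ℝ, ℝ)) (t : ℝ) : ℝ := (∫ f, (f t) ^ 2 ∂P) - (lmean P t) ^ 2

/-- The standard deviation function `σ(t)`. -/
def lsd (P : Measure C(ℝ, ℝ)) (t : ℝ) : ℝ := Real.sqrt (lvar P t)

/-- The empirical average `λ̄_n(t) = (1/n) Σ_i λ_i(t)` of a tuple of functions. -/
def empMean (n : ℕ) (l : Fin n → C(ℝ, ℝ)) (t : ℝ) : ℝ := (∑ i, l i t) / n

/-- The empirical standard deviation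
`σ̂_n(t) = sqrt((1/n) Σ_i λ_i(t)² − λ̄_n(t)²)` of a tuple of functions. -/
def empSD (n : ℕ) (l : Fin n → C(ℝ, ℝ)) (t : ℝ) : ℝ :=
  Real.sqrt ((∑ i, (l i t) ^ 2) / n - (empMean n l t) ^ 2)

/-- The standardized (adaptive) multiplier bootstrap quantile `Q̂_α(l)`: the infimum of
all `z` such that
`P_ξ(sup_{t ∈ [t₁,t₂]} |n^{−1/2} Σ_i ξ_i (l_i(t) − l̄_n(t))/σ̂_n(t)| > z) ≤ α`,
the probability taken over i.i.d. standard Gaussian multipliers `ξ` only. -/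
def adaptQuant (t₁ t₂ α : ℝ) (n : ℕ) (l : Fin n → C(ℝ, ℝ)) : ℝ :=
  sInf {z : ℝ |
    (Measure.pi fun _ : Fin n => gaussianReal 0 1)
      {ξ | z < ⨆ t : Icc t₁ t₂,
          |(∑ i, ξ i * (l i ↑t - empMean n l ↑t) / empSD n l ↑t) / Real.sqrt n|}
      ≤ ENNReal.ofReal α}

/-- The covariance function `κ(t,s) = ∫ λ(t)λ(s) dP(λ) − μ(t)μ(s)`. -/
def lcov (P : Measure C(ℝ, ℝ)) (t s : ℝ) : ℝ :=
  (∫ f, f t * f s ∂P) - lmean P t * lmean P s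

/-- The quadratic form `∑ i j, a i * a j * A i j`. -/
def quadForm {ι : Type*} [Fintype ι] (A : ι → ι → ℝ) (a : ι → ℝ) : ℝ :=
  ∑ i, ∑ j, a i * a j * A i j

/-- The random vector `X` is centered Gaussian with covariance `A`, in the sense that all its
linear functionals are. -/
def IsCenteredGaussianVector {Ω ι : Type*} [MeasurableSpace Ω] [Fintype ι] (μ : Measure Ω)
    (X : Ω → ι → ℝ) (A : ι → ι → ℝ) : Prop :=
  ∀ a : ι → ℝ, μ.map (fun ω => ∑ i, a i * X ω i) = gaussianReal 0 (quadForm A a).toNNReal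

lemma quadForm_add {ι : Type*} [Fintype ι] (A B : ι → ι → ℝ) (a : ι → ℝ) :
    quadForm (A + B) a = quadForm A a + quadForm B a := by
  simp [quadForm, mul_add, Finset.sum_add_distrib]

lemma quadForm_single {ι : Type*} [Fintype ι] [DecidableEq ι] (A : ι → ι → ℝ) (i : ι) :
    quadForm A (Pi.single i 1) = A i i := by
  simp [quadForm, Pi.single_apply]

lemma gaussianReal_abs_tail (v : NNReal) {w x : ℝ} (hw : 0 < w) (hv : (v : ℝ) ≤ w) (hx : 0 ≤ x) :
    gaussianReal 0 v {y | x < |y|} ≤ ENNReal.ofReal (2 * Real.exp (-x ^ 2 / (2 * w))) := by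
  have hsub : HasSubgaussianMGF id w.toNNReal (gaussianReal 0 v) :=
    { integrable_exp_mul := fun t => integrable_exp_mul_gaussianReal t
      mgf_le := fun t => by
        rw [mgf_id_gaussianReal]
        simp only [zero_mul, zero_add, Real.coe_toNNReal _ hw.le]
        gcongr }
  have h1 := hsub.measure_ge_le hx
  have h2 := hsub.neg.measure_ge_le hx
  rw [Real.coe_toNNReal _ hw.le] at h1 h2
  have hss : {y : ℝ | x < |y|} ⊆ {y | x ≤ id y} ∪ {y | x ≤ (-id : ℝ → ℝ) y} := by
    intro y hy
    rw [mem_ofPred_eq] at hy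
    rcases lt_abs.1 hy with h | h
    · exact Or.inl h.le
    · exact Or.inr h.le
  refine ((measure_mono hss).trans (measure_union_le _ _)).trans ?_
  rw [two_mul, ENNReal.ofReal_add (by positivity) (by positivity)]
  exact add_le_add (ENNReal.le_ofReal_iff_toReal_le (measure_ne_top _ _) (by positivity) |>.2 h1)
    (ENNReal.le_ofReal_iff_toReal_le (measure_ne_top _ _) (by positivity) |>.2 h2)

namespace IsCenteredGaussianVector

variable {Ω Ω' ι : Type*} [MeasurableSpace Ω] [MeasurableSpace Ω'] [Fintype ι]
  {μ : Measure Ω} {X : Ω → ι → ℝ} {A : ι → ι → ℝ}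

lemma aemeasurable_sum (h : IsCenteredGaussianVector μ X A) (a : ι → ℝ) :
    AEMeasurable (fun ω => ∑ i, a i * X ω i) μ := by
  apply AEMeasurable.of_map_ne_zero
  rw [h a]
  exact IsProbabilityMeasure.ne_zero _

lemma aemeasurable (h : IsCenteredGaussianVector μ X A) : AEMeasurable X μ := by
  classical
  refine aemeasurable_pi_lambda _ fun i => ?_
  simpa [Pi.single_apply] using h.aemeasurable_sum (Pi.single i 1)

lemma tail_sum (h : IsCenteredGaussianVector μ X A) (a : ι → ℝ) {w x : ℝ} (hw : 0 < w)
    (ha : quadForm A a ≤ w) (hx : 0 ≤ x) :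
    μ {ω | x < |∑ i, a i * X ω i|} ≤ ENNReal.ofReal (2 * Real.exp (-x ^ 2 / (2 * w))) := by
  have hm : MeasurableSet {y : ℝ | x < |y|} := measurableSet_lt measurable_const (by fun_prop)
  have := gaussianReal_abs_tail (quadForm A a).toNNReal hw (by simp [ha, hw.le]) hx
  rwa [← h a, Measure.map_apply_of_aemeasurable (h.aemeasurable_sum a) hm] at this

lemma tail_exists (h : IsCenteredGaussianVector μ X A) {w x : ℝ} (hw : 0 < w)
    (ha : ∀ i, A i i ≤ w) (hx : 0 ≤ x) :
    μ {ω | ∃ i, x < |X ω i|} ≤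
      Fintype.card ι * ENNReal.ofReal (2 * Real.exp (-x ^ 2 / (2 * w))) := by
  classical
  have hss : {ω | ∃ i, x < |X ω i|} = ⋃ i, {ω | x < |X ω i|} := by ext; simp
  rw [hss]
  refine (measure_iUnion_fintype_le _ _).trans ?_
  rw [← nsmul_eq_mul]
  refine Finset.sum_le_card_nsmul _ _ _ fun i _ => ?_
  simpa [Pi.single_apply] using
    h.tail_sum (Pi.single i 1) hw (by rw [quadForm_single]; exact ha i) hx

lemma map_id (h : IsCenteredGaussianVector μ X A) :
    IsCenteredGaussianVector (μ.map X) id A := by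
  intro a
  rw [AEMeasurable.map_map_of_aemeasurable (Measurable.aemeasurable (by fun_prop)) h.aemeasurable]
  exact h a

lemma isProbabilityMeasure (h : IsCenteredGaussianVector μ X A) : IsProbabilityMeasure μ := by
  have h0 := h 0
  have : IsProbabilityMeasure (μ.map (fun ω => ∑ i, (0 : ι → ℝ) i * X ω i)) := by
    rw [h0]; infer_instance
  exact (Measure.isProbabilityMeasure_map_iff (h.aemeasurable_sum 0)).1 this

lemma conv {ν₁ ν₂ : Measure (ι → ℝ)} {B : ι → ι → ℝ}
    (h₁ : IsCenteredGaussianVector ν₁ id A) (h₂ : IsCenteredGaussianVector ν₂ id B)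
    (hA : ∀ a, 0 ≤ quadForm A a) (hB : ∀ a, 0 ≤ quadForm B a) :
    IsCenteredGaussianVector (ν₁ ∗ ν₂) id (A + B) := by
  intro a
  have := h₁.isProbabilityMeasure
  have := h₂.isProbabilityMeasure
  let L : (ι → ℝ) →L[ℝ] ℝ := ∑ i, a i • ContinuousLinearMap.proj i
  have hL : ⇑L = fun x => ∑ i, a i * (id x : ι → ℝ) i := by ext; simp [L]
  rw [← hL, Measure.map_conv_continuousLinearMap, hL, h₁ a, h₂ a, gaussianReal_conv_gaussianReal,
    quadForm_add, Real.toNNReal_add (hA a) (hB a), add_zero]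

lemma ext {ν₁ ν₂ : Measure (ι → ℝ)}
    (h₁ : IsCenteredGaussianVector ν₁ id A) (h₂ : IsCenteredGaussianVector ν₂ id A) :
    ν₁ = ν₂ := by
  classical
  have := h₁.isProbabilityMeasure
  have := h₂.isProbabilityMeasure
  refine Measure.ext_of_charFunDual (funext fun L => ?_)
  have hL : ⇑L = fun x => ∑ i, L (Pi.single i 1) * (id x : ι → ℝ) i := by
    ext x
    conv_lhs => rw [← Finset.univ_sum_single x, map_sum]
    refine Finset.sum_congr rfl fun i _ => ?_
    rw [← mul_one (x i), ← smul_eq_mul, Pi.single_smul, map_smul, smul_eq_mul, mul_comm]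
    rfl
  rw [charFunDual_eq_charFun_map_one, charFunDual_eq_charFun_map_one, hL, h₁, h₂]

end IsCenteredGaussianVector

lemma map_sum_mul_pi_gaussianReal {κ : Type*} [Fintype κ] (b : κ → ℝ) :
    (Measure.pi fun _ : κ => gaussianReal 0 1).map (fun ξ => ∑ k, ξ k * b k) =
      gaussianReal 0 (∑ k, b k ^ 2).toNNReal := by
  have hind : iIndepFun (fun k (ξ : κ → ℝ) => ξ k * b k)
      (Measure.pi fun _ : κ => gaussianReal 0 1) :=
    iIndepFun_pi (X := fun k (y : ℝ) => y * b k) fun k => by fun_prop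
  refine Measure.ext_of_charFun (funext fun t => ?_)
  rw [hind.charFun_map_fun_sum_eq_prod (fun k => ((measurable_pi_apply k).mul_const (b k)).aemeasurable), Finset.prod_apply]
  have hk : ∀ k, charFun ((Measure.pi fun _ : κ => gaussianReal 0 1).map (fun ξ => ξ k * b k)) t =
      Complex.exp (-((b k : ℂ) ^ 2 * t ^ 2 / 2)) := by
    intro k
    have : (fun ξ : κ → ℝ => ξ k * b k) = (fun y => y * b k) ∘ Function.eval k := rfl
    rw [this, ← Measure.map_map (by fun_prop) (by fun_prop),
      (measurePreserving_eval (fun _ : κ => gaussianReal 0 1) k).map_eq,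
      gaussianReal_map_mul_const, charFun_gaussianReal]
    simp
  rw [Finset.prod_congr rfl fun k _ => hk k, ← Complex.exp_sum, charFun_gaussianReal,
    Real.coe_toNNReal _ (Finset.sum_nonneg fun k _ => sq_nonneg _)]
  congr 1
  push_cast
  rw [Finset.sum_neg_distrib, Finset.sum_mul, Finset.sum_div]
  simp

lemma isCenteredGaussianVector_linear {κ ι : Type*} [Fintype κ] [Fintype ι] (B : κ → ι → ℝ) :
    IsCenteredGaussianVector (Measure.pi fun _ : κ => gaussianReal 0 1)
      (fun ξ i => ∑ k, ξ k * B k i) (fun i j => ∑ k, B k i * B k j) := by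
  intro a
  have h1 : (fun ξ : κ → ℝ => ∑ i, a i * ∑ k, ξ k * B k i) =
      fun ξ => ∑ k, ξ k * ∑ i, a i * B k i := by
    ext ξ
    simp only [Finset.mul_sum]
    rw [Finset.sum_comm]
    exact Finset.sum_congr rfl fun _ _ => Finset.sum_congr rfl fun _ _ => by ring
  have h2 : quadForm (fun i j => ∑ k, B k i * B k j) a = ∑ k, (∑ i, a i * B k i) ^ 2 := by
    have h3 : ∀ k, (∑ i, a i * B k i) ^ 2 = ∑ i, ∑ j, a i * a j * (B k i * B k j) := fun k => by
      rw [sq, Finset.sum_mul_sum]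
      exact Finset.sum_congr rfl fun _ _ => Finset.sum_congr rfl fun _ _ => by ring
    simp only [quadForm, h3, Finset.mul_sum]
    rw [Finset.sum_comm (s := Finset.univ (α := κ))]
    exact Finset.sum_congr rfl fun _ _ => Finset.sum_comm
  rw [h1, map_sum_mul_pi_gaussianReal, h2]

lemma exists_isCenteredGaussianVector {ι : Type*} [Fintype ι] (A : ι → ι → ℝ)
    (hsymm : ∀ i j, A i j = A j i) (hA : ∀ a, 0 ≤ quadForm A a) :
    ∃ ν : Measure (ι → ℝ), IsCenteredGaussianVector ν id A := by
  have hpsd : (Matrix.of A).PosSemidef := by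
    refine Matrix.posSemidef_iff_dotProduct_mulVec.2 ⟨?_, fun x => ?_⟩
    · ext i j
      simpa using hsymm j i
    · convert! hA x using 1
      simp only [quadForm, dotProduct, Matrix.mulVec, Matrix.of_apply, Finset.mul_sum]
      exact Finset.sum_congr rfl fun _ _ => Finset.sum_congr rfl fun _ _ => by simp; ring
  obtain ⟨m, v, hv⟩ := Matrix.posSemidef_iff_eq_sum_vecMulVec.1 hpsd
  have hAv : A = fun i j => ∑ k, v k i * v k j := by
    ext i j
    have := congrFun (congrFun hv i) j
    simpa [Matrix.sum_apply, Matrix.vecMulVec_apply] using this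
  rw [hAv]
  exact ⟨_, (isCenteredGaussianVector_linear v).map_id⟩

lemma measurableSet_exists_lt_abs {ι : Type*} [Finite ι] (z : ℝ) :
    MeasurableSet {x : ι → ℝ | ∃ i, z < |x i|} := by
  have : {x : ι → ℝ | ∃ i, z < |x i|} = ⋃ i, {x | z < |x i|} := by ext; simp
  rw [this]
  exact MeasurableSet.iUnion fun i => measurableSet_lt measurable_const (by fun_prop)

lemma measure_exists_lt_abs_le_conv {ι : Type*} [Fintype ι] (ν₁ ν₂ : Measure (ι → ℝ))
    [IsProbabilityMeasure ν₁] [IsProbabilityMeasure ν₂] (z r : ℝ) :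
    ν₁ {x | ∃ i, z + r < |x i|} ≤ (ν₁ ∗ ν₂) {x | ∃ i, z < |x i|} + ν₂ {x | ∃ i, r < |x i|} := by
  have hfst := (measurePreserving_fst (μ := ν₁) (ν := ν₂)).measure_preimage
    (measurableSet_exists_lt_abs (ι := ι) (z + r)).nullMeasurableSet
  have hsnd := (measurePreserving_snd (μ := ν₁) (ν := ν₂)).measure_preimage
    (measurableSet_exists_lt_abs (ι := ι) r).nullMeasurableSet
  rw [← hfst, ← hsnd, Measure.conv, Measure.map_apply (by fun_prop) (measurableSet_exists_lt_abs z)]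
  refine (measure_mono ?_).trans (measure_union_le _ _)
  rintro ⟨x, y⟩ ⟨i, hi⟩
  by_contra! hcon
  simp only [mem_union, mem_preimage, mem_ofPred_eq, Pi.add_apply, not_or, not_exists,
    not_lt] at hcon hi
  have h3 : |x i| ≤ |x i + y i| + |y i| := by
    simpa using abs_sub (x i + y i) (y i)
  linarith [hcon.1 i, hcon.2 i]

lemma conv_measure_exists_lt_abs_le {ι : Type*} [Fintype ι] (ν₁ ν₂ : Measure (ι → ℝ))
    [IsProbabilityMeasure ν₁] [IsProbabilityMeasure ν₂] (z r : ℝ) :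
    (ν₁ ∗ ν₂) {x | ∃ i, z + r < |x i|} ≤ ν₁ {x | ∃ i, z < |x i|} + ν₂ {x | ∃ i, r < |x i|} := by
  have hfst := (measurePreserving_fst (μ := ν₁) (ν := ν₂)).measure_preimage
    (measurableSet_exists_lt_abs (ι := ι) z).nullMeasurableSet
  have hsnd := (measurePreserving_snd (μ := ν₁) (ν := ν₂)).measure_preimage
    (measurableSet_exists_lt_abs (ι := ι) r).nullMeasurableSet
  rw [← hfst, ← hsnd, Measure.conv,
    Measure.map_apply (by fun_prop) (measurableSet_exists_lt_abs (z + r))]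
  refine (measure_mono ?_).trans (measure_union_le _ _)
  rintro ⟨x, y⟩ ⟨i, hi⟩
  by_contra! hcon
  simp only [mem_union, mem_preimage, mem_ofPred_eq, Pi.add_apply, not_or, not_exists,
    not_lt] at hcon hi
  linarith [hcon.1 i, hcon.2 i, abs_add_le (x i) (y i)]

lemma abs_quadForm_le {ι : Type*} [Fintype ι] (D : ι → ι → ℝ) {Δ : ℝ}
    (hD : ∀ i j, |D i j| ≤ Δ) (a : ι → ℝ) :
    |quadForm D a| ≤ Fintype.card ι * Δ * ∑ i, a i ^ 2 := by
  have h1 : |quadForm D a| ≤ ∑ i, ∑ j, |a i| * |a j| * Δ := by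
    refine (Finset.abs_sum_le_sum_abs _ _).trans (Finset.sum_le_sum fun i _ => ?_)
    refine (Finset.abs_sum_le_sum_abs _ _).trans (Finset.sum_le_sum fun j _ => ?_)
    rw [abs_mul, abs_mul]
    exact mul_le_mul_of_nonneg_left (hD i j) (by positivity)
  have h2 : ∑ i, ∑ j, |a i| * |a j| * Δ = (∑ i, |a i|) ^ 2 * Δ := by
    rw [sq, Finset.sum_mul_sum]
    simp only [Finset.sum_mul]
  have h3 : (∑ i, |a i|) ^ 2 ≤ Fintype.card ι * ∑ i, a i ^ 2 := by
    simpa using sq_sum_le_card_mul_sum_sq (s := Finset.univ) (f := fun i => |a i|)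
  rcases isEmpty_or_nonempty ι with hι | ⟨⟨i⟩⟩
  · simp [quadForm]
  · have hΔ : 0 ≤ Δ := (abs_nonneg _).trans (hD i i)
    nlinarith [mul_le_mul_of_nonneg_right h3 hΔ]

/-- Comparison of the maxima of two centered Gaussian vectors with close covariances. -/
lemma gaussian_max_comparison {Ω Ω' ι : Type*} [MeasurableSpace Ω] [MeasurableSpace Ω'] [Fintype ι]
    {μ : Measure Ω} {μ' : Measure Ω'} {X : Ω → ι → ℝ} {Y : Ω' → ι → ℝ} {A B : ι → ι → ℝ}
    (hX : IsCenteredGaussianVector μ X A) (hY : IsCenteredGaussianVector μ' Y B)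
    (hAs : ∀ i j, A i j = A j i) (hBs : ∀ i j, B i j = B j i)
    (hA : ∀ a, 0 ≤ quadForm A a) (hB : ∀ a, 0 ≤ quadForm B a)
    {Δ : ℝ} (hΔ : 0 < Δ) (hAB : ∀ i j, |A i j - B i j| ≤ Δ) {r : ℝ} (hr : 0 ≤ r) (z : ℝ) :
    μ {ω | ∃ i, z + 2 * r < |X ω i|} ≤ μ' {ω | ∃ i, z < |Y ω i|} +
      2 * (Fintype.card ι * ENNReal.ofReal
        (2 * Real.exp (-r ^ 2 / (2 * (2 * Fintype.card ι * Δ))))) := by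
  classical
  rcases isEmpty_or_nonempty ι with hι | hι
  · simp
  have hcard : (1 : ℝ) ≤ Fintype.card ι := by
    exact_mod_cast Nat.one_le_iff_ne_zero.2 Fintype.card_ne_zero
  set w : ℝ := 2 * Fintype.card ι * Δ with hw
  have hw0 : 0 < w := by positivity
  let N : ι → ι → ℝ := fun i j => if i = j then Fintype.card ι * Δ else 0
  have hNq : ∀ a, quadForm N a = Fintype.card ι * Δ * ∑ i, a i ^ 2 := by
    intro a
    simp only [quadForm, N, mul_ite, mul_zero, Finset.sum_ite_eq, Finset.mem_univ, if_true,
      Finset.mul_sum]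
    exact Finset.sum_congr rfl fun _ _ => by ring
  have hN : ∀ a, 0 ≤ quadForm N a := fun a => by
    rw [hNq]
    exact mul_nonneg (by positivity) (Finset.sum_nonneg fun i _ => sq_nonneg _)
  have hNs : ∀ i j, N i j = N j i := fun i j => by simp [N, eq_comm]
  let D : ι → ι → ℝ := fun i j => B i j - A i j
  have hDΔ : ∀ i j, |D i j| ≤ Δ := fun i j => by
    simp only [D]; rw [abs_sub_comm]; exact hAB i j
  have hM : ∀ a, 0 ≤ quadForm (D + N) a := fun a => by
    rw [quadForm_add, hNq]
    linarith [neg_le_of_abs_le (abs_quadForm_le D hDΔ a)]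
  obtain ⟨νN, hνN⟩ := exists_isCenteredGaussianVector N hNs hN
  obtain ⟨νM, hνM⟩ := exists_isCenteredGaussianVector (D + N)
    (fun i j => by simp only [Pi.add_apply, D]; rw [hNs, hAs, hBs]) hM
  have := hνN.isProbabilityMeasure
  have := hνM.isProbabilityMeasure
  have := hX.map_id.isProbabilityMeasure
  have := hY.map_id.isProbabilityMeasure
  have heq : μ.map X ∗ νM = μ'.map Y ∗ νN := by
    refine IsCenteredGaussianVector.ext (hX.map_id.conv hνM hA hM) ?_
    convert hY.map_id.conv hνN hB hN using 1
    ext i j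
    simp only [Pi.add_apply, D]
    ring
  have hND : ∀ i, N i i ≤ w := fun i => by
    simp only [N, if_true, hw]; nlinarith
  have hMD : ∀ i, (D + N) i i ≤ w := fun i => by
    simp only [Pi.add_apply, N, if_true, hw]
    nlinarith [le_of_abs_le (hDΔ i i)]
  have e1 := measure_exists_lt_abs_le_conv (μ.map X) νM (z + r) r
  have e2 := conv_measure_exists_lt_abs_le (μ'.map Y) νN z r
  rw [heq] at e1
  rw [Measure.map_apply_of_aemeasurable hX.aemeasurable (measurableSet_exists_lt_abs _)] at e1
  rw [Measure.map_apply_of_aemeasurable hY.aemeasurable (measurableSet_exists_lt_abs _)] at e2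
  have t1 := hνM.tail_exists hw0 hMD hr
  have t2 := hνN.tail_exists hw0 hND hr
  calc μ {ω | ∃ i, z + 2 * r < |X ω i|} = μ (X ⁻¹' {x | ∃ i, z + r + r < |x i|}) := by
        simp only [preimage_ofPred_eq, two_mul, add_assoc]
    _ ≤ _ := e1
    _ ≤ (μ' (Y ⁻¹' {x | ∃ i, z < |x i|}) + νN {x | ∃ i, r < |x i|}) +
        νM {x | ∃ i, r < |x i|} := by gcongr
    _ ≤ (μ' (Y ⁻¹' {x | ∃ i, z < |x i|}) + _) + _ := add_le_add (add_le_add le_rfl t2) t1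
    _ = _ := by simp only [preimage_ofPred_eq]; ring

/-- The `j`-th point of the regular subdivision of `[t₁, t₂]` into `N` intervals. -/
def gridPoint (t₁ t₂ : ℝ) (N j : ℕ) : ℝ := t₁ + (j / N : ℝ) * (t₂ - t₁)

lemma gridPoint_mem {t₁ t₂ : ℝ} (h : t₁ ≤ t₂) {N j : ℕ} (hj : j ≤ N) :
    gridPoint t₁ t₂ N j ∈ Icc t₁ t₂ := by
  have h0 : (0 : ℝ) ≤ j / N := by positivity
  have h1 : (j / N : ℝ) ≤ 1 := div_le_one_of_le₀ (by exact_mod_cast hj) (by positivity)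
  constructor <;> unfold gridPoint <;> nlinarith

lemma gridPoint_mul_two (t₁ t₂ : ℝ) (N j : ℕ) :
    gridPoint t₁ t₂ (N * 2) (j * 2) = gridPoint t₁ t₂ N j := by
  simp only [gridPoint, Nat.cast_mul, Nat.cast_ofNat]
  rw [mul_div_mul_right _ _ two_ne_zero]

lemma gridPoint_succ_sub (t₁ t₂ : ℝ) (N j : ℕ) :
    gridPoint t₁ t₂ N (j + 1) - gridPoint t₁ t₂ N j = (t₂ - t₁) / N := by
  simp only [gridPoint, Nat.cast_add, Nat.cast_one]
  ring

lemma exists_gridPoint_close {t₁ t₂ : ℝ} (h : t₁ < t₂) {N : ℕ} (hN : 0 < N) {t : ℝ}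
    (ht : t ∈ Icc t₁ t₂) : ∃ j ≤ N, |t - gridPoint t₁ t₂ N j| ≤ (t₂ - t₁) / N := by
  have hl : 0 < t₂ - t₁ := sub_pos.2 h
  have hN' : (0 : ℝ) < N := by exact_mod_cast hN
  set y := (t - t₁) / (t₂ - t₁) * N with hy
  have hy0 : 0 ≤ y := by have := sub_nonneg.2 ht.1; positivity
  have hyN : y ≤ N := by
    have : (t - t₁) / (t₂ - t₁) ≤ 1 := (div_le_one hl).2 (by linarith [ht.2])
    nlinarith
  refine ⟨⌊y⌋₊, Nat.floor_le_of_le hyN, ?_⟩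
  have e : t - gridPoint t₁ t₂ N ⌊y⌋₊ = (y - ⌊y⌋₊) * ((t₂ - t₁) / N) := by
    simp only [gridPoint, hy]
    field_simp
    ring
  rw [e, abs_mul, abs_of_pos (div_pos hl hN')]
  have h1 := Nat.floor_le hy0
  have h2 := Nat.lt_floor_add_one y
  have h3 : |y - ⌊y⌋₊| ≤ 1 := abs_le.2 ⟨by linarith, by linarith⟩
  exact mul_le_of_le_one_left (by positivity) h3

/-- Control of a continuous function by its values on a grid and its increments along the
successive dyadic refinements of that grid. -/
lemma abs_le_of_dyadic_increments {t₁ t₂ : ℝ} (h : t₁ < t₂) {f : ℝ → ℝ}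
    (hf : ContinuousOn f (Icc t₁ t₂)) {p : ℕ} (hp : 0 < p) {x : ℕ → ℝ} (hx0 : ∀ k, 0 ≤ x k)
    {ρ z : ℝ} (hx : ∀ K, ∑ k ∈ Finset.range K, x k ≤ ρ)
    (hinc : ∀ k, ∀ j < p * 2 ^ (k + 1), |f (gridPoint t₁ t₂ (p * 2 ^ (k + 1)) (j + 1)) -
      f (gridPoint t₁ t₂ (p * 2 ^ (k + 1)) j)| ≤ x k)
    (hz : ∀ j ≤ p, |f (gridPoint t₁ t₂ p j)| ≤ z) {t : ℝ} (ht : t ∈ Icc t₁ t₂) :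
    |f t| ≤ z + ρ := by
  have hgrid : ∀ k, ∀ j ≤ p * 2 ^ k,
      |f (gridPoint t₁ t₂ (p * 2 ^ k) j)| ≤ z + ∑ i ∈ Finset.range k, x i := by
    intro k
    induction k with
    | zero => simpa using hz
    | succ k ih =>
      intro j hj
      rw [Finset.sum_range_succ]
      rcases Nat.even_or_odd' j with ⟨i, rfl | rfl⟩
      · rw [pow_succ, ← mul_assoc, mul_comm 2 i, gridPoint_mul_two]
        have := ih i (by rw [pow_succ, ← mul_assoc] at hj; omega)
        linarith [hx0 k]
      · have h1 := hinc k (2 * i) (by omega)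
        have h2 : |f (gridPoint t₁ t₂ (p * 2 ^ (k + 1)) (2 * i))| ≤
            z + ∑ i ∈ Finset.range k, x i := by
          rw [pow_succ, ← mul_assoc, mul_comm 2 i, gridPoint_mul_two]
          exact ih i (by rw [pow_succ, ← mul_assoc] at hj; omega)
        have h3 := abs_sub_abs_le_abs_sub (f (gridPoint t₁ t₂ (p * 2 ^ (k + 1)) (2 * i + 1)))
          (f (gridPoint t₁ t₂ (p * 2 ^ (k + 1)) (2 * i)))
        linarith
  have hpk : ∀ k, 0 < p * 2 ^ k := fun k => by positivity
  choose j hj hjt using fun k => exists_gridPoint_close h (hpk k) ht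
  have hlim : Tendsto (fun k => gridPoint t₁ t₂ (p * 2 ^ k) (j k)) atTop (nhds t) := by
    rw [tendsto_iff_dist_tendsto_zero]
    refine squeeze_zero (fun _ => dist_nonneg) (g := fun k => (t₂ - t₁) * (1 / 2 : ℝ) ^ k)
      (fun k => ?_) ?_
    · rw [dist_comm, Real.dist_eq]
      refine (hjt k).trans ?_
      rw [div_eq_mul_inv]
      refine mul_le_mul_of_nonneg_left ?_ (sub_nonneg.2 h.le)
      rw [one_div, inv_pow]
      refine inv_anti₀ (by positivity) ?_
      push_cast
      have : (1 : ℝ) ≤ p := by exact_mod_cast hp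
      exact le_mul_of_one_le_left (by positivity) this
    · simpa using (tendsto_pow_atTop_nhds_zero_of_lt_one (by norm_num : (0 : ℝ) ≤ 1 / 2)
        (by norm_num)).const_mul (t₂ - t₁)
  have hmem : ∀ k, gridPoint t₁ t₂ (p * 2 ^ k) (j k) ∈ Icc t₁ t₂ :=
    fun k => gridPoint_mem h.le (hj k)
  have hlim' := ((hf t ht).tendsto.comp
    (tendsto_nhdsWithin_iff.2 ⟨hlim, Eventually.of_forall hmem⟩)).abs
  exact le_of_tendsto hlim' (Eventually.of_forall fun k =>
    (hgrid k _ (hj k)).trans (by linarith [hx k]))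

/-- The supremum over `[t₁, t₂]` of a continuous process with sub-Gaussian Lipschitz increments is
close to its maximum over a grid. -/
lemma measure_lt_iSup_abs_le {Ω : Type*} [MeasurableSpace Ω] {μ : Measure Ω} {X : Ω → ℝ → ℝ}
    {t₁ t₂ : ℝ} (h : t₁ < t₂) (hX : ∀ ω, ContinuousOn (X ω) (Icc t₁ t₂)) {L : ℝ} (hL : 0 < L)
    (htail : ∀ s ∈ Icc t₁ t₂, ∀ t ∈ Icc t₁ t₂, s < t → ∀ x, 0 ≤ x →
      μ {ω | x < |X ω t - X ω s|} ≤
        ENNReal.ofReal (2 * Real.exp (-x ^ 2 / (2 * (L * (t - s)) ^ 2))))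
    {p : ℕ} (hp : 0 < p) {ρ : ℝ} (hρ : 0 < ρ) {u : ℝ}
    (hu : u = (ρ * p / (L * (t₂ - t₁))) ^ 2 / 8) (hu4 : Real.exp (-u) ≤ 1 / 4) (z : ℝ) :
    μ {ω | z + ρ < ⨆ t : Icc t₁ t₂, |X ω t|} ≤
      μ {ω | ∃ j : Fin (p + 1), z < |X ω (gridPoint t₁ t₂ p j)|} +
        ENNReal.ofReal (8 * p * Real.exp (-u)) := by
  have hl : 0 < t₂ - t₁ := sub_pos.2 h
  have hp' : (0 : ℝ) < p := by exact_mod_cast hp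
  let x : ℕ → ℝ := fun k => ρ / 4 * (3 / 4) ^ k
  have hx0 : ∀ k, 0 ≤ x k := fun k => by positivity
  have hx : ∀ K, ∑ k ∈ Finset.range K, x k ≤ ρ := by
    intro K
    rw [← Finset.mul_sum, geom_sum_eq (by norm_num)]
    have : (0 : ℝ) ≤ (3 / 4) ^ K := by positivity
    have e : ρ / 4 * (((3 / 4 : ℝ) ^ K - 1) / (3 / 4 - 1)) = ρ * (1 - (3 / 4) ^ K) := by ring
    rw [e]
    nlinarith
  let g : ℕ → ℕ → ℝ := fun k j => gridPoint t₁ t₂ (p * 2 ^ (k + 1)) j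
  let E : ℕ → Set Ω := fun k => ⋃ j : Fin (p * 2 ^ (k + 1)),
    {ω | x k < |X ω (g k (j + 1)) - X ω (g k j)|}
  have hsub : {ω | z + ρ < ⨆ t : Icc t₁ t₂, |X ω t|} ⊆
      {ω | ∃ j : Fin (p + 1), z < |X ω (gridPoint t₁ t₂ p j)|} ∪ ⋃ k, E k := by
    intro ω hω
    by_contra hcon
    simp only [mem_union, mem_ofPred_eq, mem_iUnion, E, not_or, not_exists, not_lt] at hcon hω
    have hne : Nonempty (Icc t₁ t₂) := ⟨⟨t₁, left_mem_Icc.2 h.le⟩⟩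
    refine absurd hω (not_lt.2 (ciSup_le fun t => ?_))
    exact abs_le_of_dyadic_increments h (hX ω) hp hx0 hx
      (fun k j hj => hcon.2 k ⟨j, hj⟩) (fun j hj => hcon.1 ⟨j, Nat.lt_succ_of_le hj⟩) t.2
  refine (measure_mono hsub).trans ((measure_union_le _ _).trans (add_le_add le_rfl ?_))
  have hEk : ∀ k, μ (E k) ≤ ENNReal.ofReal (4 * p * Real.exp (-u) * (1 / 2) ^ k) := by
    intro k
    refine (measure_iUnion_fintype_le _ _).trans ?_
    have hone : ∀ j : Fin (p * 2 ^ (k + 1)), μ {ω | x k < |X ω (g k (j + 1)) - X ω (g k j)|} ≤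
        ENNReal.ofReal (2 * Real.exp (-u * (k + 1))) := by
      intro j
      have hd := gridPoint_succ_sub t₁ t₂ (p * 2 ^ (k + 1)) j
      have hd0 : 0 < (t₂ - t₁) / ((p * 2 ^ (k + 1) : ℕ) : ℝ) := by push_cast; positivity
      refine (htail _ (gridPoint_mem h.le j.2.le) _ (gridPoint_mem h.le j.2) (by linarith) (x k)
        (hx0 k)).trans (ENNReal.ofReal_le_ofReal ?_)
      rw [hd]
      gcongr
      have hbern : (1 : ℝ) + k ≤ (9 / 4) ^ k := by
        have := one_add_mul_le_pow (by norm_num : (-2 : ℝ) ≤ 5 / 4) k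
        have e : (1 + 5 / 4 : ℝ) = 9 / 4 := by norm_num
        rw [e] at this
        have hk : (0 : ℝ) ≤ k := by positivity
        linarith
      have hu0 : 0 ≤ u := by rw [hu]; positivity
      have e : -x k ^ 2 / (2 * (L * ((t₂ - t₁) / ((p * 2 ^ (k + 1) : ℕ) : ℝ))) ^ 2) =
          -u * (9 / 4) ^ k := by
        have e94 : (9 / 4 : ℝ) ^ k = ((3 / 4) ^ k) ^ 2 * (2 ^ k) ^ 2 := by
          rw [← pow_mul, ← pow_mul, mul_comm k 2, pow_mul, pow_mul, ← mul_pow]; norm_num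
        rw [e94, hu]
        simp only [x]
        push_cast
        rw [pow_succ (2 : ℝ) k]
        field_simp
        ring
      rw [e]
      nlinarith
    refine (Finset.sum_le_card_nsmul _ _ _ fun j _ => hone j).trans ?_
    rw [Finset.card_univ, Fintype.card_fin, nsmul_eq_mul, ← ENNReal.ofReal_natCast,
      ← ENNReal.ofReal_mul (by positivity)]
    refine ENNReal.ofReal_le_ofReal ?_
    have e1 : Real.exp (-u * (k + 1)) = Real.exp (-u) * Real.exp (-u) ^ k := by
      rw [← Real.exp_nat_mul, ← Real.exp_add]; ring_nf
    have e2 : Real.exp (-u) ^ k ≤ (1 / 4) ^ k := by gcongr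
    have e3 : (2 : ℝ) ^ k * (1 / 4) ^ k = (1 / 2) ^ k := by rw [← mul_pow]; norm_num
    rw [e1, ← e3]
    push_cast
    rw [pow_succ (2 : ℝ) k]
    have : (p : ℝ) * (2 ^ k * 2) * (2 * (Real.exp (-u) * Real.exp (-u) ^ k)) =
      4 * p * Real.exp (-u) * (2 ^ k * Real.exp (-u) ^ k) := by ring
    rw [this]
    gcongr
  refine (measure_iUnion_le _).trans ((ENNReal.tsum_le_tsum hEk).trans ?_)
  rw [← ENNReal.ofReal_tsum_of_nonneg (fun k => by positivity)
    (summable_geometric_two.mul_left _), tsum_mul_left, tsum_geometric_two]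
  exact ENNReal.ofReal_le_ofReal (by linarith)

lemma IsLandscapeType.abs_sub_le {T : ℝ} {f : ℝ → ℝ} (hf : IsLandscapeType T f) (t s : ℝ) :
    |f t - f s| ≤ |t - s| := by
  simpa [Real.dist_eq] using hf.1.dist_le_mul t s

lemma measurableSet_isLandscapeType (T : ℝ) :
    MeasurableSet {f : C(ℝ, ℝ) | IsLandscapeType T f} := by
  refine IsClosed.measurableSet ?_
  have he : ∀ t : ℝ, Continuous fun f : C(ℝ, ℝ) => f t := fun t => continuous_eval_const t
  have : {f : C(ℝ, ℝ) | IsLandscapeType T f} =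
      (⋂ t : ℝ, ⋂ s : ℝ, {f : C(ℝ, ℝ) | |f t - f s| ≤ |t - s|}) ∩
        ((⋂ t : ℝ, {f : C(ℝ, ℝ) | 0 ≤ f t ∧ f t ≤ T / 2}) ∩
          ⋂ t : ℝ, ⋂ _ : t ∉ Icc (0 : ℝ) T, {f : C(ℝ, ℝ) | f t = 0}) := by
    ext f
    simp only [mem_inter_iff, mem_iInter, mem_ofPred_eq]
    constructor
    · intro h
      exact ⟨h.abs_sub_le, h.2.1, h.2.2⟩
    · rintro ⟨h1, h2, h3⟩
      refine ⟨LipschitzWith.of_dist_le_mul fun t s => ?_, h2, h3⟩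
      simpa [Real.dist_eq] using h1 t s
  rw [this]
  refine (isClosed_iInter fun t => isClosed_iInter fun s =>
    isClosed_le (((he t).sub (he s)).abs) continuous_const).inter
      ((isClosed_iInter fun t => (isClosed_le continuous_const (he t)).inter
        (isClosed_le (he t) continuous_const)).inter
          (isClosed_iInter fun t => isClosed_iInter fun _ => isClosed_eq (he t) continuous_const))

section LandscapeMeasure

variable {T : ℝ} {P : Measure C(ℝ, ℝ)} [IsProbabilityMeasure P]

lemma ae_isLandscapeType (hP : P {f | IsLandscapeType T f} = 1) :
    ∀ᵐ f : C(ℝ, ℝ) ∂P, IsLandscapeType T f :=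
  (mem_ae_iff_prob_eq_one (measurableSet_isLandscapeType T)).2 hP

lemma measurable_eval_continuousMap (t : ℝ) : Measurable fun f : C(ℝ, ℝ) => f t :=
  (continuous_eval_const t).measurable

lemma memLp_eval (hP : ∀ᵐ f : C(ℝ, ℝ) ∂P, IsLandscapeType T f) (t : ℝ) :
    MemLp (fun f : C(ℝ, ℝ) => f t) 2 P := by
  refine MemLp.of_bound (measurable_eval_continuousMap t).aestronglyMeasurable (T / 2) ?_
  filter_upwards [hP] with f hf
  rw [Real.norm_eq_abs, abs_of_nonneg (hf.2.1 t).1]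
  exact (hf.2.1 t).2

lemma lcov_eq_covariance (hP : ∀ᵐ f : C(ℝ, ℝ) ∂P, IsLandscapeType T f) (t s : ℝ) :
    lcov P t s = cov[fun f : C(ℝ, ℝ) => f t, fun f : C(ℝ, ℝ) => f s; P] := by
  rw [covariance_eq_sub (memLp_eval hP t) (memLp_eval hP s)]
  rfl

lemma lcov_comm (P : Measure C(ℝ, ℝ)) (t s : ℝ) : lcov P t s = lcov P s t := by
  simp only [lcov, mul_comm]

lemma lcov_self (P : Measure C(ℝ, ℝ)) (t : ℝ) : lcov P t t = lvar P t := by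
  simp only [lcov, lvar, sq]

lemma quadForm_lcov_nonneg (hP : ∀ᵐ f : C(ℝ, ℝ) ∂P, IsLandscapeType T f) {ι : Type*} [Fintype ι]
    (s : ι → ℝ) (a : ι → ℝ) : 0 ≤ quadForm (fun i j => lcov P (s i) (s j)) a := by
  have hm : ∀ i, MemLp (fun f : C(ℝ, ℝ) => a i * f (s i)) 2 P :=
    fun i => (memLp_eval hP (s i)).const_mul (a i)
  have h := variance_nonneg (fun f : C(ℝ, ℝ) => ∑ i, a i * f (s i)) P
  rw [← covariance_self (memLp_finsetSum _ fun i _ => hm i).aestronglyMeasurable.aemeasurable,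
    covariance_fun_sum_fun_sum hm hm] at h
  simp only [covariance_const_mul_left, covariance_const_mul_right, ← lcov_eq_covariance hP] at h
  simpa only [quadForm, mul_assoc, mul_left_comm] using h

lemma lvar_nonneg (hP : ∀ᵐ f : C(ℝ, ℝ) ∂P, IsLandscapeType T f) (t : ℝ) : 0 ≤ lvar P t := by
  have h := quadForm_lcov_nonneg hP (fun _ : Unit => t) (fun _ => 1)
  simpa [quadForm, lcov_self] using h

lemma lsd_sq (hP : ∀ᵐ f : C(ℝ, ℝ) ∂P, IsLandscapeType T f) (t : ℝ) : lsd P t ^ 2 = lvar P t :=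
  Real.sq_sqrt (lvar_nonneg hP t)

lemma lvar_add_lvar_sub_le (hP : ∀ᵐ f : C(ℝ, ℝ) ∂P, IsLandscapeType T f) (t s : ℝ) :
    lvar P t + lvar P s - 2 * lcov P t s ≤ (t - s) ^ 2 := by
  have ht := memLp_eval hP t
  have hs := memLp_eval hP s
  have hv : Var[fun f : C(ℝ, ℝ) => f t - f s; P] = lvar P t + lvar P s - 2 * lcov P t s := by
    have hm : AEMeasurable (fun f : C(ℝ, ℝ) => f t - f s) P :=
      (ht.sub hs).aestronglyMeasurable.aemeasurable
    rw [← covariance_self hm, covariance_fun_sub_fun_sub ht hs ht hs]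
    simp only [← lcov_eq_covariance hP, lcov_self, lcov_comm P s t]
    ring
  rw [← hv]
  refine (variance_le_expectation_sq (ht.sub hs).aestronglyMeasurable).trans ?_
  calc ∫ f : C(ℝ, ℝ), (f t - f s) ^ 2 ∂P ≤ ∫ _ : C(ℝ, ℝ), (t - s) ^ 2 ∂P := by
        refine integral_mono_ae (ht.sub hs).integrable_sq (integrable_const _) ?_
        filter_upwards [hP] with f hf
        exact sq_le_sq.2 (hf.abs_sub_le t s)
    _ = (t - s) ^ 2 := by simp

lemma lmean_mem (hP : ∀ᵐ f : C(ℝ, ℝ) ∂P, IsLandscapeType T f) (t : ℝ) : lmean P t ∈ Icc 0 (T / 2) := by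
  constructor
  · refine integral_nonneg_of_ae ?_
    filter_upwards [hP] with f hf using (hf.2.1 t).1
  · calc ∫ f : C(ℝ, ℝ), f t ∂P ≤ ∫ _ : C(ℝ, ℝ), T / 2 ∂P := by
          refine integral_mono_ae ((memLp_eval hP t).integrable (by norm_num))
            (integrable_const _) ?_
          filter_upwards [hP] with f hf using (hf.2.1 t).2
      _ = T / 2 := by simp

lemma lvar_sub_le (hP : ∀ᵐ f : C(ℝ, ℝ) ∂P, IsLandscapeType T f) (t s : ℝ) :
    lvar P t - lvar P s ≤ 2 * T * |t - s| := by
  have hinteg : ∀ t, Integrable (fun f : C(ℝ, ℝ) => f t) P :=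
    fun t => (memLp_eval hP t).integrable (by norm_num)
  have h1 : (∫ f : C(ℝ, ℝ), f t ^ 2 ∂P) - ∫ f : C(ℝ, ℝ), f s ^ 2 ∂P ≤ T * |t - s| := by
    rw [← integral_sub (memLp_eval hP t).integrable_sq (memLp_eval hP s).integrable_sq]
    calc ∫ f : C(ℝ, ℝ), f t ^ 2 - f s ^ 2 ∂P ≤ ∫ _ : C(ℝ, ℝ), T * |t - s| ∂P := by
          refine integral_mono_ae ((memLp_eval hP t).integrable_sq.sub
            (memLp_eval hP s).integrable_sq) (integrable_const _) ?_
          filter_upwards [hP] with f hf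
          have h2 := hf.abs_sub_le t s
          have h3 := hf.2.1 t
          have h4 := hf.2.1 s
          have h5 := le_abs_self (f t - f s)
          nlinarith [abs_nonneg (t - s)]
      _ = T * |t - s| := by simp
  have h2 : lmean P s - lmean P t ≤ |t - s| := by
    unfold lmean
    rw [← integral_sub (hinteg s) (hinteg t)]
    calc ∫ f : C(ℝ, ℝ), f s - f t ∂P ≤ ∫ _ : C(ℝ, ℝ), |t - s| ∂P := by
          refine integral_mono_ae ((hinteg s).sub (hinteg t)) (integrable_const _) ?_
          filter_upwards [hP] with f hf
          have h2 := hf.abs_sub_le s t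
          rw [abs_sub_comm s t] at h2
          exact (le_abs_self _).trans h2
      _ = |t - s| := by simp
  have h3 := lmean_mem hP t
  have h4 := lmean_mem hP s
  unfold lvar
  nlinarith [abs_nonneg (t - s), h3.1, h3.2, h4.1, h4.2]

end LandscapeMeasure

/-- The standardized covariance function `κ_σ(t,s) = κ(t,s)/(σ(t)σ(s))`. -/
def ncov (P : Measure C(ℝ, ℝ)) (t s : ℝ) : ℝ := lcov P t s / (lsd P t * lsd P s)

lemma ncov_comm (P : Measure C(ℝ, ℝ)) (t s : ℝ) : ncov P t s = ncov P s t := by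
  simp only [ncov, lcov_comm P t s, mul_comm]

section StandardizedCovariance

variable {T : ℝ} {P : Measure C(ℝ, ℝ)} [IsProbabilityMeasure P]

lemma quadForm_ncov_nonneg (hP : ∀ᵐ f : C(ℝ, ℝ) ∂P, IsLandscapeType T f) {ι : Type*} [Fintype ι]
    (s : ι → ℝ) (a : ι → ℝ) : 0 ≤ quadForm (fun i j => ncov P (s i) (s j)) a := by
  refine (quadForm_lcov_nonneg hP s fun i => a i / lsd P (s i)).trans_eq ?_
  refine Finset.sum_congr rfl fun i _ => Finset.sum_congr rfl fun j _ => ?_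
  simp only [ncov, div_eq_mul_inv, mul_inv]
  ring

lemma ncov_self (hP : ∀ᵐ f : C(ℝ, ℝ) ∂P, IsLandscapeType T f) {t : ℝ} (ht : 0 < lsd P t) :
    ncov P t t = 1 := by
  rw [ncov, lcov_self, ← lsd_sq hP t]
  field_simp

lemma ncov_increment_le (hP : ∀ᵐ f : C(ℝ, ℝ) ∂P, IsLandscapeType T f) {c t s : ℝ} (hc : 0 < c)
    (ht : c ≤ lsd P t) (hs : c ≤ lsd P s) : 2 - 2 * ncov P t s ≤ (1 / c * (t - s)) ^ 2 := by
  have h := lvar_add_lvar_sub_le hP t s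
  rw [← lsd_sq hP t, ← lsd_sq hP s] at h
  have ht0 := hc.trans_le ht
  have hs0 := hc.trans_le hs
  have h1 : lsd P t * lsd P s * (2 - 2 * ncov P t s) ≤ (t - s) ^ 2 := by
    have : lsd P t * lsd P s * (2 - 2 * ncov P t s) = 2 * (lsd P t * lsd P s) - 2 * lcov P t s := by
      unfold ncov
      field_simp
    rw [this]
    nlinarith [sq_nonneg (lsd P t - lsd P s)]
  have h2 : c ^ 2 ≤ lsd P t * lsd P s := by nlinarith
  rw [mul_pow, div_pow, one_pow, one_div_mul_eq_div, le_div_iff₀ (by positivity)]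
  rcases le_total (2 - 2 * ncov P t s) 0 with h3 | h3
  · nlinarith [sq_nonneg (t - s), sq_nonneg c]
  · nlinarith

end StandardizedCovariance

/-- The empirical measure of a tuple of functions. -/
def empMeasure (n : ℕ) (l : Fin n → C(ℝ, ℝ)) : Measure C(ℝ, ℝ) :=
  (n : ENNReal)⁻¹ • ∑ i, Measure.dirac (l i)

section Empirical

variable {T : ℝ} {n : ℕ}

lemma integral_empMeasure (l : Fin n → C(ℝ, ℝ)) (g : C(ℝ, ℝ) → ℝ) :
    ∫ f, g f ∂(empMeasure n l) = (∑ i, g (l i)) / n := by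
  rw [empMeasure, integral_smul_measure,
    integral_finsetSum_measure fun i _ => integrable_dirac (by simp [enorm_lt_top])]
  simp [integral_dirac, div_eq_inv_mul]

lemma isProbabilityMeasure_empMeasure (hn : n ≠ 0) (l : Fin n → C(ℝ, ℝ)) :
    IsProbabilityMeasure (empMeasure n l) := by
  refine ⟨?_⟩
  simp only [empMeasure, Measure.smul_apply, Measure.finsetSum_apply, measure_univ,
    Finset.sum_const, Finset.card_univ, Fintype.card_fin, nsmul_eq_mul, mul_one, smul_eq_mul]
  exact ENNReal.inv_mul_cancel (by exact_mod_cast hn) (ENNReal.natCast_ne_top n)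

lemma ae_empMeasure_isLandscapeType {l : Fin n → C(ℝ, ℝ)} (hl : ∀ i, IsLandscapeType T (l i)) :
    ∀ᵐ f : C(ℝ, ℝ) ∂(empMeasure n l), IsLandscapeType T f := by
  rw [ae_iff, empMeasure, Measure.smul_apply, Measure.finsetSum_apply]
  have : ∀ i, Measure.dirac (l i) {f : C(ℝ, ℝ) | ¬ IsLandscapeType T f} = 0 := fun i => by
    have h := Measure.dirac_apply' (l i) (measurableSet_isLandscapeType T).compl
    rw [compl_ofPred] at h
    simp [h, hl i]
  simp [this]

lemma lmean_empMeasure (l : Fin n → C(ℝ, ℝ)) (t : ℝ) :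
    lmean (empMeasure n l) t = empMean n l t :=
  integral_empMeasure l fun f => f t

lemma lsd_empMeasure (l : Fin n → C(ℝ, ℝ)) (t : ℝ) :
    lsd (empMeasure n l) t = empSD n l t := by
  rw [lsd, lvar, empSD, lmean_empMeasure, integral_empMeasure l fun f => f t ^ 2]

lemma lcov_empMeasure (l : Fin n → C(ℝ, ℝ)) (t s : ℝ) :
    lcov (empMeasure n l) t s = (∑ i, l i t * l i s) / n - empMean n l t * empMean n l s := by
  rw [lcov, lmean_empMeasure, lmean_empMeasure, integral_empMeasure l fun f => f t * f s]

lemma sum_sub_empMean_mul (hn : n ≠ 0) (l : Fin n → C(ℝ, ℝ)) (t s : ℝ) :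
    ∑ i, (l i t - empMean n l t) * (l i s - empMean n l s) = n * lcov (empMeasure n l) t s := by
  have hn' : (n : ℝ) ≠ 0 := by exact_mod_cast hn
  have h : ∀ t, ∑ i, l i t = n * empMean n l t := fun t => by
    rw [empMean]; field_simp
  simp only [sub_mul, mul_sub, Finset.sum_sub_distrib, ← Finset.mul_sum, ← Finset.sum_mul, h,
    lcov_empMeasure, Finset.sum_const, Finset.card_univ, Fintype.card_fin, nsmul_eq_mul]
  field_simp
  ring

end Empirical

/-- A process with continuous paths on `[t₁, t₂]` which is centered Gaussian with covariance
`κ_σ` there. -/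
structure IsStandardizedBridge {Ω : Type*} [MeasurableSpace Ω] (P : Measure C(ℝ, ℝ)) (t₁ t₂ : ℝ)
    (μ : Measure Ω) (X : Ω → ℝ → ℝ) : Prop where
  continuousOn : ∀ ω, ContinuousOn (X ω) (Icc t₁ t₂)
  gaussian : ∀ (m : ℕ) (s : Fin m → ℝ), (∀ i, s i ∈ Icc t₁ t₂) →
    IsCenteredGaussianVector μ (fun ω i => X ω (s i)) (fun i j => ncov P (s i) (s j))

/-- The standardized multiplier bootstrap process. -/
def bootstrapProcess (n : ℕ) (l : Fin n → C(ℝ, ℝ)) (ξ : Fin n → ℝ) (t : ℝ) : ℝ :=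
  (∑ i, ξ i * (l i t - empMean n l t) / empSD n l t) / Real.sqrt n

lemma continuous_empMean (n : ℕ) (l : Fin n → C(ℝ, ℝ)) : Continuous (empMean n l) := by
  unfold empMean
  fun_prop

lemma isStandardizedBridge_bootstrapProcess {n : ℕ} (hn : n ≠ 0) (l : Fin n → C(ℝ, ℝ))
    {t₁ t₂ : ℝ} (hσ : ∀ t ∈ Icc t₁ t₂, 0 < empSD n l t) :
    IsStandardizedBridge (empMeasure n l) t₁ t₂ (Measure.pi fun _ : Fin n => gaussianReal 0 1)
      (bootstrapProcess n l) := by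
  have hm := continuous_empMean n l
  refine ⟨fun ξ => ?_, fun m s hs => ?_⟩
  · have hsd : Continuous (empSD n l) := by
      unfold empSD
      fun_prop
    unfold bootstrapProcess
    refine ContinuousOn.div_const (continuousOn_finsetSum _ fun i _ => ?_) _
    refine ContinuousOn.div (by fun_prop) hsd.continuousOn fun t ht => (hσ t ht).ne'
  · have h := isCenteredGaussianVector_linear
      (fun (k : Fin n) (i : Fin m) => (l k (s i) - empMean n l (s i)) / empSD n l (s i) / √n)
    have hn' : (0 : ℝ) < n := by exact_mod_cast Nat.pos_of_ne_zero hn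
    convert h using 1
    · ext ξ i
      simp only [bootstrapProcess, Finset.sum_div]
      refine Finset.sum_congr rfl fun k _ => by ring
    · ext i j
      have h1 := hσ _ (hs i)
      have h2 := hσ _ (hs j)
      have h3 : √(n : ℝ) * √n = n := Real.mul_self_sqrt hn'.le
      have h4 : lcov (empMeasure n l) (s i) (s j) =
          (∑ k, (l k (s i) - empMean n l (s i)) * (l k (s j) - empMean n l (s j))) / n := by
        rw [sum_sub_empMean_mul hn]
        field_simp
      rw [ncov, h4, lsd_empMeasure, lsd_empMeasure, Finset.sum_div, Finset.sum_div]
      refine Finset.sum_congr rfl fun k _ => ?_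
      rw [div_div, div_div, div_div, div_mul_div_comm]
      congr 1
      linear_combination -(empSD n l (s i) * empSD n l (s j)) * h3

namespace IsStandardizedBridge

lemma bddAbove {Ω : Type*} [MeasurableSpace Ω] {t₁ t₂ : ℝ} {P : Measure C(ℝ, ℝ)} {μ : Measure Ω}
    {X : Ω → ℝ → ℝ} (hX : IsStandardizedBridge P t₁ t₂ μ X) (ω : Ω) :
    BddAbove (range fun t : Icc t₁ t₂ => |X ω t|) := by
  have h := (isCompact_Icc.image_of_continuousOn (hX.continuousOn ω).abs).bddAbove
  rwa [image_eq_range] at h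

variable {Ω Ω' : Type*} [MeasurableSpace Ω] [MeasurableSpace Ω'] {T t₁ t₂ c : ℝ}
  {P P' : Measure C(ℝ, ℝ)} [IsProbabilityMeasure P] [IsProbabilityMeasure P']
  {μ : Measure Ω} {μ' : Measure Ω'} {X : Ω → ℝ → ℝ} {X' : Ω' → ℝ → ℝ}

lemma increment_tail (hX : IsStandardizedBridge P t₁ t₂ μ X)
    (hP : ∀ᵐ f : C(ℝ, ℝ) ∂P, IsLandscapeType T f) (hc : 0 < c)
    (hσ : ∀ t ∈ Icc t₁ t₂, c ≤ lsd P t) {s t : ℝ} (hs : s ∈ Icc t₁ t₂) (ht : t ∈ Icc t₁ t₂)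
    (hst : s < t) {x : ℝ} (hx : 0 ≤ x) :
    μ {ω | x < |X ω t - X ω s|} ≤
      ENNReal.ofReal (2 * Real.exp (-x ^ 2 / (2 * (1 / c * (t - s)) ^ 2))) := by
  have hg := hX.gaussian 2 ![t, s] (by intro i; fin_cases i <;> simp_all)
  have hw : 0 < (1 / c * (t - s)) ^ 2 := by
    have := sub_pos.2 hst
    positivity
  have hq : quadForm (fun i j : Fin 2 => ncov P (![t, s] i) (![t, s] j)) ![1, -1]
      ≤ (1 / c * (t - s)) ^ 2 := by
    refine le_trans (le_of_eq ?_) (ncov_increment_le hP hc (hσ t ht) (hσ s hs))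
    simp only [quadForm, Fin.sum_univ_two, Matrix.cons_val_zero, Matrix.cons_val_one,
      ncov_self hP (hc.trans_le (hσ t ht)), ncov_self hP (hc.trans_le (hσ s hs)), ncov_comm P s t]
    ring
  have h := hg.tail_sum ![1, -1] hw hq hx
  simpa [Fin.sum_univ_two, ← sub_eq_add_neg] using h

lemma measure_lt_iSup_le_grid (hX : IsStandardizedBridge P t₁ t₂ μ X)
    (hP : ∀ᵐ f : C(ℝ, ℝ) ∂P, IsLandscapeType T f) (h : t₁ < t₂) (hc : 0 < c)
    (hσ : ∀ t ∈ Icc t₁ t₂, c ≤ lsd P t) {p : ℕ} (hp : 0 < p) {ρ : ℝ} (hρ : 0 < ρ) {u : ℝ}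
    (hu : u = (ρ * p / (1 / c * (t₂ - t₁))) ^ 2 / 8) (hu4 : Real.exp (-u) ≤ 1 / 4) (z : ℝ) :
    μ {ω | z + ρ < ⨆ t : Icc t₁ t₂, |X ω t|} ≤
      μ {ω | ∃ j : Fin (p + 1), z < |X ω (gridPoint t₁ t₂ p j)|} +
        ENNReal.ofReal (8 * p * Real.exp (-u)) :=
  measure_lt_iSup_abs_le h hX.continuousOn (one_div_pos.2 hc)
    (fun _ hs _ ht hst _ hx => hX.increment_tail hP hc hσ hs ht hst hx) hp hρ hu hu4 z

/-- Comparison of the suprema of two standardized bridges whose covariances are close on a grid. -/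
lemma measure_lt_iSup_le (hX : IsStandardizedBridge P t₁ t₂ μ X)
    (hX' : IsStandardizedBridge P' t₁ t₂ μ' X')
    (hP : ∀ᵐ f : C(ℝ, ℝ) ∂P, IsLandscapeType T f) (hP' : ∀ᵐ f : C(ℝ, ℝ) ∂P', IsLandscapeType T f)
    (h : t₁ < t₂) (hc : 0 < c) (hσ : ∀ t ∈ Icc t₁ t₂, c ≤ lsd P t) {p : ℕ} (hp : 0 < p)
    {r : ℝ} (hr : 0 < r) {u : ℝ} (hu : u = (r * p / (1 / c * (t₂ - t₁))) ^ 2 / 8)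
    (hu4 : Real.exp (-u) ≤ 1 / 4) {Δ : ℝ} (hΔ : 0 < Δ)
    (hPP' : ∀ i j : Fin (p + 1), |ncov P (gridPoint t₁ t₂ p i) (gridPoint t₁ t₂ p j) -
      ncov P' (gridPoint t₁ t₂ p i) (gridPoint t₁ t₂ p j)| ≤ Δ) (z : ℝ) :
    μ {ω | z + 3 * r < ⨆ t : Icc t₁ t₂, |X ω t|} ≤ μ' {ω | z < ⨆ t : Icc t₁ t₂, |X' ω t|} +
      ENNReal.ofReal (4 * (p + 1) * Real.exp (-r ^ 2 / (4 * (p + 1) * Δ)) +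
        8 * p * Real.exp (-u)) := by
  have hmem : ∀ i : Fin (p + 1), gridPoint t₁ t₂ p i ∈ Icc t₁ t₂ :=
    fun i => gridPoint_mem h.le (Nat.lt_succ_iff.1 i.2)
  have h1 := hX.measure_lt_iSup_le_grid hP h hc hσ hp hr hu hu4 (z + 2 * r)
  have h2 := gaussian_max_comparison (hX.gaussian _ _ hmem) (hX'.gaussian _ _ hmem)
    (fun _ _ => ncov_comm _ _ _) (fun _ _ => ncov_comm _ _ _) (quadForm_ncov_nonneg hP _)
    (quadForm_ncov_nonneg hP' _) hΔ hPP' hr.le z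
  have h3 : μ' {ω | ∃ j : Fin (p + 1), z < |X' ω (gridPoint t₁ t₂ p j)|} ≤
      μ' {ω | z < ⨆ t : Icc t₁ t₂, |X' ω t|} := by
    refine measure_mono ?_
    rintro ω ⟨j, hj⟩
    exact lt_of_lt_of_le hj (le_ciSup (hX'.bddAbove ω) ⟨_, hmem j⟩)
  have h4 : (2 : ENNReal) * (Fintype.card (Fin (p + 1)) * ENNReal.ofReal
        (2 * Real.exp (-r ^ 2 / (2 * (2 * Fintype.card (Fin (p + 1)) * Δ))))) =
      ENNReal.ofReal (4 * (p + 1) * Real.exp (-r ^ 2 / (4 * (p + 1) * Δ))) := by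
    rw [Fintype.card_fin, ← ENNReal.ofReal_natCast, ← ENNReal.ofReal_mul (by positivity),
      ← ENNReal.ofReal_ofNat 2, ← ENNReal.ofReal_mul (by positivity)]
    congr 1
    push_cast
    ring_nf
  rw [h4] at h2
  rw [show z + 3 * r = z + 2 * r + r by ring,
    ENNReal.ofReal_add (by positivity) (by positivity), ← add_assoc]
  exact h1.trans (by gcongr; exact h2.trans (by gcongr))

lemma exists_measure_lt_iSup_le (hX : IsStandardizedBridge P t₁ t₂ μ X)
    (hP : ∀ᵐ f : C(ℝ, ℝ) ∂P, IsLandscapeType T f) (h : t₁ < t₂) (hc : 0 < c)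
    (hσ : ∀ t ∈ Icc t₁ t₂, c ≤ lsd P t) {β : ℝ} (hβ : 0 < β) :
    ∃ z, μ {ω | z < ⨆ t : Icc t₁ t₂, |X ω t|} ≤ ENNReal.ofReal β := by
  have hl : 0 < t₂ - t₁ := sub_pos.2 h
  have hmem : ∀ i : Fin (1 + 1), gridPoint t₁ t₂ 1 i ∈ Icc t₁ t₂ :=
    fun i => gridPoint_mem h.le (Nat.lt_succ_iff.1 i.2)
  have hexp : ∀ κ : ℝ, 0 < κ → Tendsto (fun ρ : ℝ => Real.exp (-(κ * ρ ^ 2))) atTop (nhds 0) :=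
    fun κ hκ => Real.tendsto_exp_neg_atTop_nhds_zero.comp
      ((tendsto_pow_atTop two_ne_zero).const_mul_atTop hκ)
  have hκ : 0 < (1 / (1 / c * (t₂ - t₁))) ^ 2 / 8 := by positivity
  have hlim : Tendsto (fun ρ : ℝ => 4 * Real.exp (-(1 / 2 * ρ ^ 2)) +
      8 * Real.exp (-((1 / (1 / c * (t₂ - t₁))) ^ 2 / 8 * ρ ^ 2))) atTop (nhds 0) := by
    simpa using ((hexp _ one_half_pos).const_mul 4).add ((hexp _ hκ).const_mul 8)
  obtain ⟨ρ, h1, h2, hρ⟩ := ((hlim.eventually_le_const hβ).and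
    (((hexp _ hκ).eventually_le_const (by norm_num : (0 : ℝ) < 1 / 4)).and
      (eventually_gt_atTop 0))).exists
  refine ⟨ρ + ρ, ?_⟩
  have h3 := hX.measure_lt_iSup_le_grid hP h hc hσ one_pos hρ
    (u := (1 / (1 / c * (t₂ - t₁))) ^ 2 / 8 * ρ ^ 2) (by push_cast; ring) h2 ρ
  have h4 := (hX.gaussian _ _ hmem).tail_exists one_pos
    (fun i => (ncov_self hP (hc.trans_le (hσ _ (hmem i)))).le) hρ.le
  refine (h3.trans (add_le_add_left h4 _)).trans ?_
  rw [Fintype.card_fin, ← ENNReal.ofReal_natCast, ← ENNReal.ofReal_mul (by positivity),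
    ← ENNReal.ofReal_add (by positivity) (by positivity)]
  refine ENNReal.ofReal_le_ofReal (le_trans (le_of_eq ?_) h1)
  push_cast
  ring_nf

end IsStandardizedBridge

/-- The quantile function of a survival function `F`. -/
def survivalQuantile (F : ℝ → ENNReal) (β : ℝ) : ℝ := sInf {z : ℝ | F z ≤ ENNReal.ofReal β}

lemma survivalQuantile_add_le {F G : ℝ → ENNReal} {α e d : ℝ} (hα : 0 ≤ α) (he : 0 ≤ e)
    (hFG : ∀ z, F (z + d) ≤ G z + ENNReal.ofReal e) (hF : ∀ z < 0, F z = 1) (hαe : α + e < 1)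
    (hG : ∃ z, G z ≤ ENNReal.ofReal α) :
    survivalQuantile F (α + e) ≤ survivalQuantile G α + d := by
  rw [← sub_le_iff_le_add]
  refine le_csInf hG fun z hz => ?_
  rw [sub_le_iff_le_add]
  refine csInf_le ⟨0, fun w hw => ?_⟩ ?_
  · by_contra! hw0
    have h1 : F w ≤ ENNReal.ofReal (α + e) := hw
    rw [hF w hw0, ENNReal.one_le_ofReal] at h1
    linarith
  · have hz' : G z ≤ ENNReal.ofReal α := hz
    rw [mem_ofPred_eq, ENNReal.ofReal_add hα he]
    exact (hFG z).trans (by gcongr)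

lemma measure_lt_iSup_abs_of_neg {Ω : Type*} [MeasurableSpace Ω] (μ : Measure Ω)
    [IsProbabilityMeasure μ] (X : Ω → ℝ → ℝ) (t₁ t₂ : ℝ) {z : ℝ} (hz : z < 0) :
    μ {ω | z < ⨆ t : Icc t₁ t₂, |X ω t|} = 1 := by
  have : {ω | z < ⨆ t : Icc t₁ t₂, |X ω t|} = univ :=
    eq_univ_of_forall fun ω => hz.trans_le (Real.iSup_nonneg fun _ => abs_nonneg _)
  rw [this, measure_univ]

/-- Quantiles of the suprema of two standardized bridges with close covariances are close. -/
lemma IsStandardizedBridge.survivalQuantile_le {Ω Ω' : Type*} [MeasurableSpace Ω]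
    [MeasurableSpace Ω'] {T t₁ t₂ c : ℝ} {P P' : Measure C(ℝ, ℝ)} [IsProbabilityMeasure P]
    [IsProbabilityMeasure P'] {μ : Measure Ω} {μ' : Measure Ω'} [IsProbabilityMeasure μ]
    [IsProbabilityMeasure μ'] {X : Ω → ℝ → ℝ} {X' : Ω' → ℝ → ℝ}
    (hX : IsStandardizedBridge P t₁ t₂ μ X) (hX' : IsStandardizedBridge P' t₁ t₂ μ' X')
    (hP : ∀ᵐ f : C(ℝ, ℝ) ∂P, IsLandscapeType T f) (hP' : ∀ᵐ f : C(ℝ, ℝ) ∂P', IsLandscapeType T f)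
    (h : t₁ < t₂) (hc : 0 < c) (hσ : ∀ t ∈ Icc t₁ t₂, c ≤ lsd P t)
    (hσ' : ∀ t ∈ Icc t₁ t₂, c ≤ lsd P' t) {p : ℕ} (hp : 0 < p)
    {r : ℝ} (hr : 0 < r) {u : ℝ} (hu : u = (r * p / (1 / c * (t₂ - t₁))) ^ 2 / 8)
    (hu4 : Real.exp (-u) ≤ 1 / 4) {Δ : ℝ} (hΔ : 0 < Δ)
    (hPP' : ∀ i j : Fin (p + 1), |ncov P (gridPoint t₁ t₂ p i) (gridPoint t₁ t₂ p j) -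
      ncov P' (gridPoint t₁ t₂ p i) (gridPoint t₁ t₂ p j)| ≤ Δ)
    (herr : 4 * (p + 1) * Real.exp (-r ^ 2 / (4 * (p + 1) * Δ)) + 8 * p * Real.exp (-u) ≤ r)
    {α : ℝ} (hα0 : 0 < α - r) (hα1 : α + r < 1) :
    survivalQuantile (fun z => μ {ω | z < ⨆ t : Icc t₁ t₂, |X ω t|}) (α + r) ≤
        survivalQuantile (fun z => μ' {ω | z < ⨆ t : Icc t₁ t₂, |X' ω t|}) α + 3 * r ∧
      survivalQuantile (fun z => μ' {ω | z < ⨆ t : Icc t₁ t₂, |X' ω t|}) α ≤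
        survivalQuantile (fun z => μ {ω | z < ⨆ t : Icc t₁ t₂, |X ω t|}) (α - r) + 3 * r := by
  have h1 : ∀ z, μ {ω | z + 3 * r < ⨆ t : Icc t₁ t₂, |X ω t|} ≤
      μ' {ω | z < ⨆ t : Icc t₁ t₂, |X' ω t|} + ENNReal.ofReal r := fun z =>
    (hX.measure_lt_iSup_le hX' hP hP' h hc hσ hp hr hu hu4 hΔ hPP' z).trans (by gcongr)
  have h2 : ∀ z, μ' {ω | z + 3 * r < ⨆ t : Icc t₁ t₂, |X' ω t|} ≤
      μ {ω | z < ⨆ t : Icc t₁ t₂, |X ω t|} + ENNReal.ofReal r := fun z =>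
    (hX'.measure_lt_iSup_le hX hP' hP h hc hσ' hp hr hu hu4 hΔ
      (fun i j => by rw [abs_sub_comm]; exact hPP' i j) z).trans (by gcongr)
  have h3 := hX'.exists_measure_lt_iSup_le hP' h hc hσ' (by linarith : 0 < α)
  have h4 := hX.exists_measure_lt_iSup_le hP h hc hσ hα0
  refine ⟨survivalQuantile_add_le (by linarith) hr.le h1
    (fun z hz => measure_lt_iSup_abs_of_neg μ X t₁ t₂ hz) hα1 h3, ?_⟩
  have h5 := survivalQuantile_add_le hα0.le hr.le h2
    (fun z hz => measure_lt_iSup_abs_of_neg μ' X' t₁ t₂ hz) (by linarith) h4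
  rwa [sub_add_cancel] at h5

section CovarianceEstimation

variable {T : ℝ} {P P' : Measure C(ℝ, ℝ)} [IsProbabilityMeasure P] [IsProbabilityMeasure P']

lemma lsd_le (hP : ∀ᵐ f : C(ℝ, ℝ) ∂P, IsLandscapeType T f) (hT : 0 ≤ T) (t : ℝ) :
    lsd P t ≤ T := by
  refine Real.sqrt_le_iff.2 ⟨hT, ?_⟩
  have h : ∫ f : C(ℝ, ℝ), f t ^ 2 ∂P ≤ ∫ _ : C(ℝ, ℝ), T ^ 2 ∂P := by
    refine integral_mono_ae (memLp_eval hP t).integrable_sq (integrable_const _) ?_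
    filter_upwards [hP] with f hf
    have := hf.2.1 t
    exact pow_le_pow_left₀ this.1 (by linarith) 2
  have h' : ∫ _ : C(ℝ, ℝ), T ^ 2 ∂P = T ^ 2 := by simp
  unfold lvar
  nlinarith [sq_nonneg (lmean P t)]

lemma abs_ncov_le_one (hP : ∀ᵐ f : C(ℝ, ℝ) ∂P, IsLandscapeType T f) {t s : ℝ}
    (ht : 0 < lsd P t) (hs : 0 < lsd P s) : |ncov P t s| ≤ 1 := by
  have h1 := quadForm_ncov_nonneg hP ![t, s] ![1, 1]
  have h2 := quadForm_ncov_nonneg hP ![t, s] ![1, -1]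
  simp only [quadForm, Fin.sum_univ_two, Matrix.cons_val_zero, Matrix.cons_val_one,
    ncov_self hP ht, ncov_self hP hs, ncov_comm P s t] at h1 h2
  rw [abs_le]
  constructor <;> linarith

lemma abs_lsd_sub_le (hP : ∀ᵐ f : C(ℝ, ℝ) ∂P, IsLandscapeType T f)
    (hP' : ∀ᵐ f : C(ℝ, ℝ) ∂P', IsLandscapeType T f) {c y t : ℝ} (hc : 0 < c) (ht : c ≤ lsd P t)
    (h : |lvar P t - lvar P' t| ≤ y) : |lsd P t - lsd P' t| ≤ y / c := by
  rw [le_div_iff₀ hc]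
  refine le_trans ?_ h
  rw [← lsd_sq hP, ← lsd_sq hP', sq_sub_sq, abs_mul, mul_comm]
  have h' : 0 ≤ lsd P' t := Real.sqrt_nonneg _
  gcongr
  rw [abs_of_nonneg (by linarith)]
  linarith

/-- Close covariances yield close standardized covariances. -/
lemma abs_ncov_sub_le (hP : ∀ᵐ f : C(ℝ, ℝ) ∂P, IsLandscapeType T f)
    (hP' : ∀ᵐ f : C(ℝ, ℝ) ∂P', IsLandscapeType T f) (hT : 0 ≤ T) {c c' y t s : ℝ} (hc : 0 < c)
    (hc' : 0 < c') (ht : c ≤ lsd P t) (hs : c ≤ lsd P s) (ht' : c' ≤ lsd P' t)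
    (hs' : c' ≤ lsd P' s) (htt : |lvar P t - lvar P' t| ≤ y) (hss : |lvar P s - lvar P' s| ≤ y)
    (hts : |lcov P t s - lcov P' t s| ≤ y) :
    |ncov P t s - ncov P' t s| ≤ (1 + 2 * T / c) / c' ^ 2 * y := by
  have ht0 := hc.trans_le ht
  have hs0 := hc.trans_le hs
  have ht0' := hc'.trans_le ht'
  have hs0' := hc'.trans_le hs'
  have h1 := abs_lsd_sub_le hP hP' hc ht htt
  have h2 := abs_lsd_sub_le hP hP' hc hs hss
  have h3 := lsd_le hP hT s
  have h4 := lsd_le hP' hT t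
  have h5 := abs_ncov_le_one hP ht0 hs0
  have hy : 0 ≤ y / c := (abs_nonneg _).trans h1
  have key : (ncov P t s - ncov P' t s) * (lsd P' t * lsd P' s) =
      (lcov P t s - lcov P' t s) - ncov P t s * ((lsd P t - lsd P' t) * lsd P s +
        lsd P' t * (lsd P s - lsd P' s)) := by
    unfold ncov
    field_simp
    ring
  have h6 : |(lsd P t - lsd P' t) * lsd P s + lsd P' t * (lsd P s - lsd P' s)| ≤
      y / c * T + T * (y / c) := by
    refine (abs_add_le _ _).trans ?_
    rw [abs_mul, abs_mul, abs_of_pos hs0, abs_of_pos ht0']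
    gcongr
  have h7 : |ncov P t s - ncov P' t s| * (lsd P' t * lsd P' s) ≤ (1 + 2 * T / c) * y := by
    rw [← abs_of_pos (mul_pos ht0' hs0'), ← abs_mul, key]
    refine (abs_sub _ _).trans ?_
    rw [abs_mul]
    calc _ ≤ y + 1 * (y / c * T + T * (y / c)) := by gcongr
      _ = (1 + 2 * T / c) * y := by ring
  rw [div_mul_eq_mul_div, le_div_iff₀ (by positivity)]
  refine le_trans ?_ h7
  gcongr
  nlinarith

lemma lsd_lower_bound_of_grid (hP : ∀ᵐ f : C(ℝ, ℝ) ∂P, IsLandscapeType T f)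
    (hP' : ∀ᵐ f : C(ℝ, ℝ) ∂P', IsLandscapeType T f) (hT : 0 ≤ T) {t₁ t₂ c y : ℝ} (h : t₁ < t₂)
    (hc : 0 < c) (hσ : ∀ t ∈ Icc t₁ t₂, c ≤ lsd P t) {p : ℕ} (hp : 0 < p)
    (hgrid : ∀ i ≤ p, |lvar P (gridPoint t₁ t₂ p i) - lvar P' (gridPoint t₁ t₂ p i)| ≤ y)
    (hy : y ≤ c ^ 2 / 4) (hp' : 2 * T * ((t₂ - t₁) / p) ≤ c ^ 2 / 4) {t : ℝ}
    (ht : t ∈ Icc t₁ t₂) : c / 2 ≤ lsd P' t := by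
  obtain ⟨j, hj, hjt⟩ := exists_gridPoint_close h hp ht
  have h1 := abs_le.1 (hgrid j hj)
  have h2 := lvar_sub_le hP' (gridPoint t₁ t₂ p j) t
  rw [abs_sub_comm] at h2
  have h3 : 2 * T * |t - gridPoint t₁ t₂ p j| ≤ 2 * T * ((t₂ - t₁) / p) := by gcongr
  have h4 := pow_le_pow_left₀ hc.le (hσ _ (gridPoint_mem h.le hj)) 2
  rw [lsd_sq hP] at h4
  refine Real.le_sqrt_of_sq_le ?_
  rw [div_pow]
  linarith [h1.2]

end CovarianceEstimation

lemma abs_lcov_sub_empMeasure_le {T : ℝ} {P : Measure C(ℝ, ℝ)} [IsProbabilityMeasure P]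
    (hP : ∀ᵐ f : C(ℝ, ℝ) ∂P, IsLandscapeType T f) {n : ℕ} (hn : n ≠ 0) {l : Fin n → C(ℝ, ℝ)}
    (hl : ∀ i, IsLandscapeType T (l i)) {x t s : ℝ} (ht : |empMean n l t - lmean P t| ≤ x)
    (hs : |empMean n l s - lmean P s| ≤ x)
    (hts : |(∑ i, l i t * l i s) / n - ∫ f, f t * f s ∂P| ≤ x) :
    |lcov P t s - lcov (empMeasure n l) t s| ≤ (1 + T) * x := by
  have := isProbabilityMeasure_empMeasure hn l
  have h1 := lmean_mem (ae_empMeasure_isLandscapeType hl) t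
  have h2 := lmean_mem hP s
  have hx : 0 ≤ x := (abs_nonneg _).trans ht
  rw [lmean_empMeasure] at h1
  have key : lcov P t s - lcov (empMeasure n l) t s =
      -((∑ i, l i t * l i s) / n - ∫ f, f t * f s ∂P) +
        ((empMean n l t - lmean P t) * lmean P s +
          empMean n l t * (empMean n l s - lmean P s)) := by
    rw [lcov_empMeasure, lcov]
    ring
  rw [key]
  refine (abs_add_le _ _).trans ?_
  rw [abs_neg]
  have h3 : |(empMean n l t - lmean P t) * lmean P s +
      empMean n l t * (empMean n l s - lmean P s)| ≤ x * (T / 2) + T / 2 * x := by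
    refine (abs_add_le _ _).trans ?_
    rw [abs_mul, abs_mul, abs_of_nonneg h2.1, abs_of_nonneg h1.1]
    have := h1.2
    have := h2.2
    have := h2.1
    gcongr
    exact h1.1.trans h1.2
  linarith

section Hoeffding

variable {E : Type*} [MeasurableSpace E] {P : Measure E} [IsProbabilityMeasure P]

lemma pi_measure_lt_sum_le {g : E → ℝ} {v : NNReal} (hg : HasSubgaussianMGF g v P) (n : ℕ)
    (hn : n ≠ 0) {x : ℝ} (hx : 0 ≤ x) :
    (Measure.pi fun _ : Fin n => P) {l | x < (∑ i, g (l i)) / n} ≤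
      ENNReal.ofReal (Real.exp (-(n * x ^ 2 / (2 * v)))) := by
  have hn' : (0 : ℝ) < n := by exact_mod_cast Nat.pos_of_ne_zero hn
  have hsub : ∀ i : Fin n, HasSubgaussianMGF (fun l : Fin n → E => g (l i)) v
      (Measure.pi fun _ : Fin n => P) := fun i =>
    HasSubgaussianMGF.of_map (Y := fun l : Fin n → E => l i) (measurable_pi_apply i).aemeasurable
      (by rwa [(measurePreserving_eval (fun _ : Fin n => P) i).map_eq])
  have hind : iIndepFun (fun (i : Fin n) (l : Fin n → E) => g (l i))
      (Measure.pi fun _ : Fin n => P) := iIndepFun_pi fun _ => hg.aemeasurable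
  have h := HasSubgaussianMGF.measure_sum_ge_le_of_iIndepFun hind (s := Finset.univ)
    (c := fun _ => v) (fun i _ => hsub i) (ε := n * x) (by positivity)
  have h2 : Real.exp (-(n * x) ^ 2 / (2 * ((∑ _i : Fin n, v : NNReal) : ℝ))) =
      Real.exp (-(n * x ^ 2 / (2 * v))) := by
    congr 1
    simp only [Finset.sum_const, Finset.card_univ, Fintype.card_fin, nsmul_eq_mul, NNReal.coe_mul,
      NNReal.coe_natCast]
    rcases eq_or_ne (v : ℝ) 0 with hv | hv
    · simp [hv]
    · field_simp
  rw [← h2]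
  calc _ ≤ (Measure.pi fun _ : Fin n => P) {l | n * x ≤ ∑ i, g (l i)} := by
        refine measure_mono fun l hl => ?_
        rw [mem_ofPred_eq, lt_div_iff₀ hn'] at hl
        rw [mem_ofPred_eq, mul_comm]
        exact hl.le
    _ = ENNReal.ofReal ((Measure.pi fun _ : Fin n => P).real {l | n * x ≤ ∑ i, g (l i)}) :=
        (ofReal_measureReal).symm
    _ ≤ _ := ENNReal.ofReal_le_ofReal (by exact_mod_cast h)

/-- Hoeffding's inequality for sample means of bounded functions. -/
lemma pi_measure_lt_abs_mean_sub_le {g : E → ℝ} (hgm : Measurable g) {M : ℝ} (hM : 0 < M)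
    (hg : ∀ᵐ f ∂P, g f ∈ Icc 0 M) (n : ℕ) (hn : n ≠ 0) {x : ℝ} (hx : 0 ≤ x) :
    (Measure.pi fun _ : Fin n => P) {l | x < |(∑ i, g (l i)) / n - ∫ f, g f ∂P|} ≤
      ENNReal.ofReal (2 * Real.exp (-(2 * n * x ^ 2 / M ^ 2))) := by
  have hn' : (n : ℝ) ≠ 0 := by exact_mod_cast hn
  have hs := hasSubgaussianMGF_of_mem_Icc hgm.aemeasurable hg
  have h1 := pi_measure_lt_sum_le hs n hn hx
  have h2 := pi_measure_lt_sum_le hs.neg n hn hx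
  have hv : (n * x ^ 2 / (2 * (((‖M - 0‖₊ / 2) ^ 2 : NNReal) : ℝ))) = 2 * n * x ^ 2 / M ^ 2 := by
    simp only [sub_zero, NNReal.coe_pow, NNReal.coe_div, coe_nnnorm, Real.norm_eq_abs,
      NNReal.coe_ofNat, abs_of_pos hM]
    field_simp
  rw [hv] at h1 h2
  rw [two_mul, ENNReal.ofReal_add (Real.exp_nonneg _) (Real.exp_nonneg _)]
  refine (measure_mono fun l hl => ?_).trans ((measure_union_le _ _).trans (add_le_add h1 h2))
  have key : (∑ i, (g (l i) - ∫ f, g f ∂P)) / n = (∑ i, g (l i)) / n - ∫ f, g f ∂P := by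
    rw [Finset.sum_sub_distrib, sub_div]
    simp [hn']
  rw [mem_ofPred_eq, lt_abs, ← key] at hl
  refine hl.imp id fun h => ?_
  simpa only [mem_ofPred_eq, Pi.neg_apply, Finset.sum_neg_distrib, neg_div] using h

lemma pi_measure_exists_lt_abs_mean_sub_le {ι : Type*} [Fintype ι] {g : ι → E → ℝ}
    (hgm : ∀ k, Measurable (g k)) {M : ℝ} (hM : 0 < M) (hg : ∀ k, ∀ᵐ f ∂P, g k f ∈ Icc 0 M)
    (n : ℕ) (hn : n ≠ 0) {x : ℝ} (hx : 0 ≤ x) :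
    (Measure.pi fun _ : Fin n => P) {l | ∃ k, x < |(∑ i, g k (l i)) / n - ∫ f, g k f ∂P|} ≤
      ENNReal.ofReal (Fintype.card ι * (2 * Real.exp (-(2 * n * x ^ 2 / M ^ 2)))) := by
  rw [ofPred_exists]
  refine (measure_iUnion_fintype_le _ _).trans ?_
  refine (Finset.sum_le_sum fun k _ =>
    pi_measure_lt_abs_mean_sub_le (hgm k) hM (hg k) n hn hx).trans_eq ?_
  rw [Finset.sum_const, Finset.card_univ, nsmul_eq_mul, ENNReal.ofReal_mul (Nat.cast_nonneg _),
    ENNReal.ofReal_natCast]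

end Hoeffding

/-- A tuple of landscape-type functions whose first and second empirical moments are, on a grid,
within `x` of those of `P`. -/
structure IsTypicalSample (T t₁ t₂ : ℝ) (P : Measure C(ℝ, ℝ)) (p : ℕ) (x : ℝ) (n : ℕ)
    (l : Fin n → C(ℝ, ℝ)) : Prop where
  isLandscapeType : ∀ i, IsLandscapeType T (l i)
  mean : ∀ i : Fin (p + 1),
    |empMean n l (gridPoint t₁ t₂ p i) - lmean P (gridPoint t₁ t₂ p i)| ≤ x
  moment : ∀ i j : Fin (p + 1),
    |(∑ k, l k (gridPoint t₁ t₂ p i) * l k (gridPoint t₁ t₂ p j)) / n -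
      ∫ f, f (gridPoint t₁ t₂ p i) * f (gridPoint t₁ t₂ p j) ∂P| ≤ x

lemma pi_measure_not_isTypicalSample_le {T : ℝ} (hT : 0 < T) {P : Measure C(ℝ, ℝ)}
    [IsProbabilityMeasure P] (hP : ∀ᵐ f : C(ℝ, ℝ) ∂P, IsLandscapeType T f) (t₁ t₂ : ℝ) (p : ℕ)
    {x : ℝ} (hx : 0 ≤ x) (n : ℕ) (hn : n ≠ 0) :
    (Measure.pi fun _ : Fin n => P) {l | ¬ IsTypicalSample T t₁ t₂ P p x n l} ≤
      ENNReal.ofReal (4 * (p + 1) ^ 2 * Real.exp (-(2 * n * x ^ 2 / ((T + 1) ^ 2) ^ 2))) := by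
  set g : ℕ → ℝ := gridPoint t₁ t₂ p
  have hM : 0 < (T + 1) ^ 2 := by positivity
  have h0 : (Measure.pi fun _ : Fin n => P) {l | ¬ ∀ i, IsLandscapeType T (l i)} = 0 := by
    rw [← ae_iff, ae_all_iff]
    exact fun i => (measurePreserving_eval (fun _ : Fin n => P) i).quasiMeasurePreserving.ae hP
  have h1 := pi_measure_exists_lt_abs_mean_sub_le (P := P)
    (g := fun (i : Fin (p + 1)) (f : C(ℝ, ℝ)) => f (g i))
    (fun i => measurable_eval_continuousMap _) hM (fun i => by
      filter_upwards [hP] with f hf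
      have := hf.2.1 (g i)
      exact ⟨this.1, by nlinarith⟩) n hn hx
  have h2 := pi_measure_exists_lt_abs_mean_sub_le (P := P)
    (g := fun (k : Fin (p + 1) × Fin (p + 1)) (f : C(ℝ, ℝ)) => f (g k.1) * f (g k.2))
    (fun k => (measurable_eval_continuousMap _).mul (measurable_eval_continuousMap _)) hM
    (fun k => by
      filter_upwards [hP] with f hf
      have h1 := hf.2.1 (g k.1)
      have h2 := hf.2.1 (g k.2)
      exact ⟨mul_nonneg h1.1 h2.1, by nlinarith [mul_le_mul h1.2 h2.2 h2.1 (by linarith)]⟩) n hn hx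
  set e := 2 * Real.exp (-(2 * n * x ^ 2 / ((T + 1) ^ 2) ^ 2)) with he
  have he0 : 0 ≤ e := by positivity
  have hsub : {l | ¬ IsTypicalSample T t₁ t₂ P p x n l} ⊆
      {l : Fin n → C(ℝ, ℝ) | ¬ ∀ i, IsLandscapeType T (l i)} ∪
        ({l | ∃ i : Fin (p + 1), x < |(∑ k, l k (g i)) / n - ∫ f, f (g i) ∂P|} ∪
          {l | ∃ k : Fin (p + 1) × Fin (p + 1),
            x < |(∑ i, l i (g k.1) * l i (g k.2)) / n - ∫ f, f (g k.1) * f (g k.2) ∂P|}) := by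
    intro l hl
    by_contra h
    simp only [mem_union, mem_ofPred_eq, not_or, not_not, not_exists, not_lt] at h
    exact hl ⟨h.1, h.2.1, fun i j => h.2.2 (i, j)⟩
  refine (measure_mono hsub).trans ((measure_union_le _ _).trans ?_)
  rw [h0, zero_add]
  refine (measure_union_le _ _).trans ((add_le_add h1 h2).trans ?_)
  rw [← ENNReal.ofReal_add (by positivity) (by positivity)]
  refine ENNReal.ofReal_le_ofReal ?_
  simp only [Fintype.card_fin, Fintype.card_prod, Nat.cast_mul, Nat.cast_add, Nat.cast_one]
  have hp : (0 : ℝ) ≤ p := Nat.cast_nonneg p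
  calc _ ≤ ((p : ℝ) + 1) * (p + 1) * e + ((p : ℝ) + 1) * (p + 1) * e := by
        gcongr
        nlinarith
    _ = _ := by rw [he]; ring

lemma IsTypicalSample.adaptQuant_bounds {T t₁ t₂ c : ℝ} (hT : 0 < T) {P : Measure C(ℝ, ℝ)}
    [IsProbabilityMeasure P] (hP : ∀ᵐ f : C(ℝ, ℝ) ∂P, IsLandscapeType T f) (h₁₂ : t₁ < t₂)
    (hc : 0 < c) (hσ : ∀ t ∈ Icc t₁ t₂, c ≤ lsd P t) {Ω : Type*} [MeasurableSpace Ω]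
    {Q : Measure Ω} [IsProbabilityMeasure Q] {H : Ω → ℝ → ℝ}
    (hH : IsStandardizedBridge P t₁ t₂ Q H) {p : ℕ} (hp : 0 < p) {x : ℝ} (hx : 0 < x)
    (hxc : (1 + T) * x ≤ c ^ 2 / 4) (hpc : 2 * T * ((t₂ - t₁) / p) ≤ c ^ 2 / 4) {n : ℕ}
    (hn : n ≠ 0) {l : Fin n → C(ℝ, ℝ)} (hl : IsTypicalSample T t₁ t₂ P p x n l) {r : ℝ}
    (hr : 0 < r) {u : ℝ} (hu : u = (r * p / (1 / (c / 2) * (t₂ - t₁))) ^ 2 / 8)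
    (hu4 : Real.exp (-u) ≤ 1 / 4) {Δ : ℝ}
    (hΔ : Δ = (1 + 2 * T / c) / (c / 2) ^ 2 * ((1 + T) * x))
    (herr : 4 * (p + 1) * Real.exp (-r ^ 2 / (4 * (p + 1) * Δ)) + 8 * p * Real.exp (-u) ≤ r)
    {α : ℝ} (hα0 : 0 < α - r) (hα1 : α + r < 1) :
    survivalQuantile (fun z => Q {ω | z < ⨆ t : Icc t₁ t₂, |H ω t|}) (α + r) ≤
        adaptQuant t₁ t₂ α n l + 3 * r ∧
      adaptQuant t₁ t₂ α n l ≤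
        survivalQuantile (fun z => Q {ω | z < ⨆ t : Icc t₁ t₂, |H ω t|}) (α - r) + 3 * r := by
  have := isProbabilityMeasure_empMeasure hn l
  have hP' := ae_empMeasure_isLandscapeType hl.isLandscapeType
  have hcov : ∀ i ≤ p, ∀ j ≤ p,
      |lcov P (gridPoint t₁ t₂ p i) (gridPoint t₁ t₂ p j) -
        lcov (empMeasure n l) (gridPoint t₁ t₂ p i) (gridPoint t₁ t₂ p j)| ≤ (1 + T) * x :=
    fun i hi j hj => abs_lcov_sub_empMeasure_le hP hn hl.isLandscapeType
      (hl.mean ⟨i, Nat.lt_succ_of_le hi⟩) (hl.mean ⟨j, Nat.lt_succ_of_le hj⟩)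
      (hl.moment ⟨i, Nat.lt_succ_of_le hi⟩ ⟨j, Nat.lt_succ_of_le hj⟩)
  have hvar : ∀ i ≤ p, |lvar P (gridPoint t₁ t₂ p i) -
      lvar (empMeasure n l) (gridPoint t₁ t₂ p i)| ≤ (1 + T) * x := fun i hi => by
    simpa only [lcov_self] using hcov i hi i hi
  have hσ' : ∀ t ∈ Icc t₁ t₂, c / 2 ≤ lsd (empMeasure n l) t := fun t ht =>
    lsd_lower_bound_of_grid hP hP' hT.le h₁₂ hc hσ hp hvar hxc hpc ht
  have hB := isStandardizedBridge_bootstrapProcess hn l (t₁ := t₁) (t₂ := t₂) fun t ht => by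
    rw [← lsd_empMeasure]
    exact (half_pos hc).trans_le (hσ' t ht)
  have hΔ0 : 0 < Δ := by rw [hΔ]; positivity
  refine hH.survivalQuantile_le hB hP hP' h₁₂ (half_pos hc)
    (fun t ht => (half_le_self hc.le).trans (hσ t ht)) hσ' hp hr hu hu4 hΔ0 (fun i j => ?_) herr
    hα0 hα1
  have hi := Nat.lt_succ_iff.1 i.2
  have hj := Nat.lt_succ_iff.1 j.2
  rw [hΔ]
  exact abs_ncov_sub_le hP hP' hT.le hc (half_pos hc) (hσ _ (gridPoint_mem h₁₂.le hi))
    (hσ _ (gridPoint_mem h₁₂.le hj)) (hσ' _ (gridPoint_mem h₁₂.le hi))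
    (hσ' _ (gridPoint_mem h₁₂.le hj)) (hvar _ hi) (hvar _ hj) (hcov _ hi _ hj)

lemma tendsto_natCast_rpow_neg {s : ℝ} (hs : 0 < s) :
    Tendsto (fun n : ℕ => (n : ℝ) ^ (-s)) atTop (nhds 0) :=
  (tendsto_rpow_neg_atTop hs).comp tendsto_natCast_atTop_atTop

lemma tendsto_log_rpow_div_rpow :
    Tendsto (fun n : ℕ => Real.log n ^ ((3 : ℝ) / 8) / (n : ℝ) ^ ((1 : ℝ) / 8)) atTop (nhds 0) :=
  ((isLittleO_log_rpow_rpow_atTop _ (by norm_num)).tendsto_div_nhds_zero).comp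
    tendsto_natCast_atTop_atTop

lemma eventually_pow_mul_exp_neg_rpow_le {κ : ℝ} (hκ : 0 < κ) :
    ∀ᶠ n : ℕ in atTop, 36 * (n : ℝ) ^ 3 * Real.exp (-(κ * (n : ℝ) ^ ((1 : ℝ) / 30))) ≤ 1 := by
  have h1 : Tendsto (fun n : ℕ => (n : ℝ) ^ ((1 : ℝ) / 30)) atTop atTop :=
    (tendsto_rpow_atTop (by norm_num)).comp tendsto_natCast_atTop_atTop
  have h2 := ((tendsto_rpow_mul_exp_neg_mul_atTop_nhds_zero 90 κ hκ).comp h1).const_mul 36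
  rw [mul_zero] at h2
  filter_upwards [h2.eventually_le_const one_pos] with n hn
  refine le_trans (le_of_eq ?_) hn
  simp only [Function.comp_apply]
  rw [← Real.rpow_mul (Nat.cast_nonneg n), ← Real.rpow_natCast, mul_assoc, neg_mul]
  norm_num

/-- The error terms for a grid of `⌈n^(1/6)⌉` cells and moment accuracy `n^(-9/20)`. -/
lemma error_terms_le {a κ K M r : ℝ} {n : ℕ} (hn : 1 ≤ n) (ha : 0 < a) (hK : 0 < K) (hM : 0 < M)
    (hκ₁ : κ ≤ a ^ 2 / 8) (hκ₂ : κ ≤ 1 / (12 * K)) (hκ₃ : κ ≤ 2 / M)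
    (hκn : 36 * (n : ℝ) ^ 3 * Real.exp (-(κ * (n : ℝ) ^ ((1 : ℝ) / 30))) ≤ 1)
    (hr : (n : ℝ) ^ (-(1 / 8 : ℝ)) ≤ r) {p : ℕ} (hp : p = ⌈(n : ℝ) ^ ((1 : ℝ) / 6)⌉₊)
    {x u Δ : ℝ} (hx : x = (n : ℝ) ^ (-(9 / 20 : ℝ))) (hu : u = (r * p * a) ^ 2 / 8)
    (hΔ : Δ = K * x) :
    Real.exp (-u) ≤ 1 / 4 ∧
      4 * (p + 1) * Real.exp (-r ^ 2 / (4 * (p + 1) * Δ)) + 8 * p * Real.exp (-u) ≤ r ∧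
      4 * ((p : ℝ) + 1) ^ 2 * Real.exp (-(2 * n * x ^ 2 / M)) ≤ 5 / n := by
  have hn1 : (1 : ℝ) ≤ n := by exact_mod_cast hn
  have hn0 : (0 : ℝ) < n := by linarith
  set q := (n : ℝ) ^ ((1 : ℝ) / 6) with hq
  set w := (n : ℝ) ^ ((1 : ℝ) / 30) with hw
  set e := Real.exp (-(κ * w)) with he
  have hq1 : 1 ≤ q := Real.one_le_rpow hn1 (by norm_num)
  have hqn : q ≤ n := by
    simpa only [Real.rpow_one] using
      Real.rpow_le_rpow_of_exponent_le hn1 (by norm_num : (1 : ℝ) / 6 ≤ 1)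
  have hw1 : 1 ≤ w := Real.one_le_rpow hn1 (by norm_num)
  have hqp : q ≤ p := by rw [hp]; exact Nat.le_ceil q
  have hpq : (p : ℝ) ≤ q + 1 := by rw [hp]; exact (Nat.ceil_lt_add_one (by linarith)).le
  have hx0 : 0 < x := by rw [hx]; positivity
  have hs0 : 0 < (n : ℝ) ^ (-(1 / 8 : ℝ)) := by positivity
  have hr0 : 0 < r := hs0.trans_le hr
  have hnr : 1 / (n : ℝ) ≤ r := by
    refine le_trans ?_ hr
    rw [one_div, ← Real.rpow_neg_one]
    exact Real.rpow_le_rpow_of_exponent_le hn1 (by norm_num)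
  have hu' : κ * w ≤ u := by
    have h1 : (n : ℝ) ^ ((1 : ℝ) / 24) ≤ r * p := by
      calc (n : ℝ) ^ ((1 : ℝ) / 24) = (n : ℝ) ^ (-(1 / 8 : ℝ)) * q := by
            rw [hq, ← Real.rpow_add hn0]; norm_num
        _ ≤ r * p := by gcongr
    have h2 : w ≤ (r * p) ^ 2 := by
      calc w ≤ (n : ℝ) ^ ((1 : ℝ) / 12) :=
            Real.rpow_le_rpow_of_exponent_le hn1 (by norm_num)
        _ = ((n : ℝ) ^ ((1 : ℝ) / 24)) ^ 2 := by
            rw [← Real.rpow_natCast, ← Real.rpow_mul hn0.le]; norm_num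
        _ ≤ (r * p) ^ 2 := by gcongr
    calc κ * w ≤ a ^ 2 / 8 * (r * p) ^ 2 := by gcongr
      _ = u := by rw [hu]; ring
  have hv' : κ * w ≤ r ^ 2 / (4 * (p + 1) * Δ) := by
    rw [le_div_iff₀ (by rw [hΔ]; positivity), hΔ]
    have h1 : w * q * x = ((n : ℝ) ^ (-(1 / 8 : ℝ))) ^ 2 := by
      rw [← Real.rpow_natCast, ← Real.rpow_mul hn0.le, hw, hq, hx, ← Real.rpow_add hn0,
        ← Real.rpow_add hn0]
      norm_num
    calc κ * w * (4 * (p + 1) * (K * x)) ≤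
          1 / (12 * K) * w * (4 * (3 * q) * (K * x)) := by
          gcongr
          linarith
      _ = w * q * x := by field_simp; ring
      _ ≤ r ^ 2 := by rw [h1]; gcongr
  have hy' : κ * w ≤ 2 * n * x ^ 2 / M := by
    have h1 : w ≤ n * x ^ 2 := by
      calc w ≤ (n : ℝ) ^ ((1 : ℝ) / 10) :=
            Real.rpow_le_rpow_of_exponent_le hn1 (by norm_num)
        _ = n ^ (1 : ℝ) * x ^ 2 := by
            rw [← Real.rpow_natCast, hx, ← Real.rpow_mul hn0.le, ← Real.rpow_add hn0]
            norm_num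
        _ = n * x ^ 2 := by rw [Real.rpow_one]
    calc κ * w ≤ 2 / M * (n * x ^ 2) := by gcongr
      _ = 2 * n * x ^ 2 / M := by ring
  have hue : Real.exp (-u) ≤ e := Real.exp_le_exp.2 (neg_le_neg hu')
  have hve : Real.exp (-r ^ 2 / (4 * (p + 1) * Δ)) ≤ e := by
    rw [neg_div]
    exact Real.exp_le_exp.2 (neg_le_neg hv')
  have hye : Real.exp (-(2 * n * x ^ 2 / M)) ≤ e := Real.exp_le_exp.2 (neg_le_neg hy')
  have he0 : 0 < e := Real.exp_pos _
  have hn3 : 1 ≤ (n : ℝ) ^ 3 := one_le_pow₀ hn1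
  have hp3 : (p : ℝ) + 1 ≤ 3 * n := by linarith
  refine ⟨hue.trans ?_, ?_, ?_⟩
  · nlinarith
  · refine le_trans ?_ hnr
    rw [le_div_iff₀ hn0]
    calc (4 * (p + 1) * Real.exp (-r ^ 2 / (4 * (p + 1) * Δ)) + 8 * p * Real.exp (-u)) * n
        ≤ (4 * (3 * n) * e + 8 * (3 * n) * e) * n := by
          gcongr
          linarith
      _ = 36 * (n : ℝ) ^ 2 * e := by ring
      _ ≤ 36 * (n : ℝ) ^ 3 * e := by
          gcongr
          · norm_num
      _ ≤ 1 := hκn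
  · rw [le_div_iff₀ hn0]
    calc 4 * ((p : ℝ) + 1) ^ 2 * Real.exp (-(2 * n * x ^ 2 / M)) * n
        ≤ 4 * (3 * n) ^ 2 * e * n := by gcongr
      _ = 36 * (n : ℝ) ^ 3 * e := by ring
      _ ≤ 5 := by linarith

/-- **Estimation error of the bootstrap quantile.**  Let `P` be concentrated on
landscape-type functions with `σ(t) ≥ c > 0` on `[t₁,t₂] ⊆ [0,T]`, let `ℍ` (denoted `H`)
be the standardized Brownian bridge with covariance `κ_σ(t,s) = κ(t,s)/(σ(t)σ(s))`, and
let `Q(β) = inf{z : P(sup_{t∈[t₁,t₂]} |ℍ(t)| > z) ≤ β}` (denoted `Qfun`).  Then for every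
`α ∈ (0,1)` there are `C₁₂, C₁₃ > 0` and `N₀` such that for all `n ≥ N₀`, with
`r_n = (log n)^{3/8} n^{−1/8}`:
(i) `Pⁿ(Q̂_α < Q(α + C₁₂ r_n) − C₁₃ r_n) ≤ 5/n`, and
(ii) `Pⁿ(Q̂_α > Q(α − C₁₂ r_n) + C₁₃ r_n) ≤ 5/n`. -/
theorem bootstrap_quantile_estimation (T : ℝ) (hT : 0 < T)
    (P : Measure C(ℝ, ℝ)) [IsProbabilityMeasure P]
    (hP : P {f | IsLandscapeType T f} = 1)
    (t₁ t₂ c : ℝ) (ht₁ : 0 ≤ t₁) (h₁₂ : t₁ < t₂) (ht₂ : t₂ ≤ T) (hc : 0 < c)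
    (hσ : ∀ t ∈ Icc t₁ t₂, c ≤ lsd P t)
    (Ω : Type) [MeasurableSpace Ω] (Q : Measure Ω) [IsProbabilityMeasure Q]
    (H : Ω → ℝ → ℝ)
    (hHcont : ∀ ω, ContinuousOn (H ω) (Icc t₁ t₂))
    (hHgauss : ∀ (m : ℕ) (s : Fin m → ℝ), (∀ i, s i ∈ Icc t₁ t₂) → ∀ a : Fin m → ℝ,
      Measure.map (fun ω => ∑ i, a i * H ω (s i)) Q =
        gaussianReal 0
          (∑ i, ∑ j, a i * a j *
            (lcov P (s i) (s j) / (lsd P (s i) * lsd P (s j)))).toNNReal)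
    (Qfun : ℝ → ℝ)
    (hQfun : ∀ β : ℝ, Qfun β =
      sInf {z : ℝ | Q {ω | z < ⨆ t : Icc t₁ t₂, |H ω ↑t|} ≤ ENNReal.ofReal β})
    (α : ℝ) (hα0 : 0 < α) (hα1 : α < 1) :
    ∃ C₁₂ > (0 : ℝ), ∃ C₁₃ > (0 : ℝ), ∃ N₀ : ℕ, ∀ n ≥ N₀,
      ((Measure.pi fun _ : Fin n => P)
          {l | adaptQuant t₁ t₂ α n l <
              Qfun (α + C₁₂ * (Real.log n ^ ((3 : ℝ) / 8) / (n : ℝ) ^ ((1 : ℝ) / 8)))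
                - C₁₃ * (Real.log n ^ ((3 : ℝ) / 8) / (n : ℝ) ^ ((1 : ℝ) / 8))}
        ≤ 5 / n) ∧
      ((Measure.pi fun _ : Fin n => P)
          {l | Qfun (α - C₁₂ * (Real.log n ^ ((3 : ℝ) / 8) / (n : ℝ) ^ ((1 : ℝ) / 8)))
                + C₁₃ * (Real.log n ^ ((3 : ℝ) / 8) / (n : ℝ) ^ ((1 : ℝ) / 8))
              < adaptQuant t₁ t₂ α n l}
        ≤ 5 / n) := by
  have hP' := ae_isLandscapeType hP
  have hH : IsStandardizedBridge P t₁ t₂ Q H := ⟨hHcont, hHgauss⟩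
  have hl : 0 < t₂ - t₁ := sub_pos.2 h₁₂
  set a : ℝ := c / 2 / (t₂ - t₁) with ha
  set K : ℝ := (1 + 2 * T / c) / (c / 2) ^ 2 * (1 + T) with hK
  set M : ℝ := ((T + 1) ^ 2) ^ 2 with hM
  have ha0 : 0 < a := by positivity
  have hK0 : 0 < K := by positivity
  have hM0 : 0 < M := by positivity
  obtain ⟨κ, hκ0, hκ₁, hκ₂, hκ₃⟩ :
      ∃ κ : ℝ, 0 < κ ∧ κ ≤ a ^ 2 / 8 ∧ κ ≤ 1 / (12 * K) ∧ κ ≤ 2 / M :=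
    ⟨min (a ^ 2 / 8) (min (1 / (12 * K)) (2 / M)),
      lt_min (by positivity) (lt_min (by positivity) (by positivity)), min_le_left _ _,
      (min_le_right _ _).trans (min_le_left _ _), (min_le_right _ _).trans (min_le_right _ _)⟩
  have hlog : ∀ᶠ n : ℕ in atTop, 1 ≤ Real.log n :=
    (Real.tendsto_log_atTop.comp tendsto_natCast_atTop_atTop).eventually_ge_atTop 1
  have hx : ∀ᶠ n : ℕ in atTop, (1 + T) * (n : ℝ) ^ (-(9 / 20 : ℝ)) ≤ c ^ 2 / 4 := by
    have h := (tendsto_natCast_rpow_neg (by norm_num : (0 : ℝ) < 9 / 20)).const_mul (1 + T)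
    rw [mul_zero] at h
    exact h.eventually_le_const (by positivity)
  have hq : ∀ᶠ n : ℕ in atTop,
      2 * T * (t₂ - t₁) * (n : ℝ) ^ (-(1 / 6 : ℝ)) ≤ c ^ 2 / 4 := by
    have h := (tendsto_natCast_rpow_neg (by norm_num : (0 : ℝ) < 1 / 6)).const_mul
      (2 * T * (t₂ - t₁))
    rw [mul_zero] at h
    exact h.eventually_le_const (by positivity)
  obtain ⟨N₀, hN₀⟩ := eventually_atTop.1 (hlog.and (hx.and (hq.and
    ((eventually_pow_mul_exp_neg_rpow_le hκ0).and ((eventually_ge_atTop 1).and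
      ((tendsto_log_rpow_div_rpow.eventually_lt_const hα0).and
        (tendsto_log_rpow_div_rpow.eventually_lt_const (sub_pos.2 hα1))))))))
  refine ⟨1, one_pos, 3, by norm_num, N₀, fun n hn => ?_⟩
  obtain ⟨hlog, hx, hq, hκn, hn1, hrα, hrα'⟩ := hN₀ n hn
  have hn0 : (0 : ℝ) < n := by exact_mod_cast hn1
  set r : ℝ := Real.log n ^ ((3 : ℝ) / 8) / (n : ℝ) ^ ((1 : ℝ) / 8)
  have hr : (n : ℝ) ^ (-(1 / 8 : ℝ)) ≤ r := by
    rw [Real.rpow_neg hn0.le, ← one_div]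
    exact div_le_div_of_nonneg_right (Real.one_le_rpow hlog (by norm_num)) (by positivity)
  have hr0 : 0 < r := lt_of_lt_of_le (by positivity) hr
  set p := ⌈(n : ℝ) ^ ((1 : ℝ) / 6)⌉₊ with hp
  have hq0 : 0 < (n : ℝ) ^ ((1 : ℝ) / 6) := by positivity
  have hp0 : 0 < p := Nat.ceil_pos.2 hq0
  have hpc : 2 * T * ((t₂ - t₁) / p) ≤ c ^ 2 / 4 := by
    refine le_trans ?_ hq
    rw [Real.rpow_neg hn0.le, mul_assoc (2 * T), ← div_eq_mul_inv]
    gcongr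
    exact Nat.le_ceil _
  have hu : (r * p * a) ^ 2 / 8 = (r * p / (1 / (c / 2) * (t₂ - t₁))) ^ 2 / 8 := by
    rw [ha]
    field_simp
  obtain ⟨hu4, herr, hbad⟩ := error_terms_le hn1 ha0 hK0 hM0 hκ₁ hκ₂ hκ₃ hκn hr hp rfl rfl rfl
  have hbad' : (Measure.pi fun _ : Fin n => P)
      {l | ¬ IsTypicalSample T t₁ t₂ P p ((n : ℝ) ^ (-(9 / 20 : ℝ))) n l} ≤ 5 / n := by
    refine (pi_measure_not_isTypicalSample_le hT hP' t₁ t₂ p (by positivity) n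
      (Nat.one_le_iff_ne_zero.1 hn1)).trans ((ENNReal.ofReal_le_ofReal hbad).trans_eq ?_)
    rw [ENNReal.ofReal_div_of_pos hn0, ENNReal.ofReal_natCast, ENNReal.ofReal_ofNat]
  have hgood : ∀ l, IsTypicalSample T t₁ t₂ P p ((n : ℝ) ^ (-(9 / 20 : ℝ))) n l →
      Qfun (α + 1 * r) ≤ adaptQuant t₁ t₂ α n l + 3 * r ∧
        adaptQuant t₁ t₂ α n l ≤ Qfun (α - 1 * r) + 3 * r := by
    intro l hl
    rw [one_mul, hQfun, hQfun]
    exact hl.adaptQuant_bounds hT hP' h₁₂ hc hσ hH hp0 (by positivity) hx hpc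
      (Nat.one_le_iff_ne_zero.1 hn1) hr0 hu hu4
      (Δ := K * (n : ℝ) ^ (-(9 / 20 : ℝ))) (by rw [hK]; ring) herr (by linarith)
      (by linarith)
  refine ⟨(measure_mono fun l hl => ?_).trans hbad', (measure_mono fun l hl => ?_).trans hbad'⟩
  · intro htyp
    have h := (hgood l htyp).1
    rw [mem_ofPred_eq] at hl
    linarith
  · intro htyp
    have h := (hgood l htyp).2
    rw [mem_ofPred_eq] at hl
    linarith
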